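/- For every ε > 0 and δ > 0 there exist c > 0 and N such that for all n ≥ N and all integers 2 ≤ ℓ ≤ c·n, with probability at least 1 − δ the Hajós number h of a uniformly random ℓ-lift of K_n satisfies (1−ε)·√(2nℓ/(1−1/ℓ)) ≤ h ≤ (1+ε)·√(2nℓ/(1−1/ℓ)). -/

import Mathlib

/-- The `ℓ`-lift of the complete graph `K_n` determined by a family of permutations
`σ` (only the values `σ i j` for `i < j` matter): vertices `(i,a)` and `(j, σ i j a)`
are adjacent for `i < j`. -/
def liftGraph (n ℓ : ℕ) (σ : Fin n → Fin n → Equiv.Perm (Fin ℓ)) :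
    SimpleGraph (Fin n × Fin ℓ) :=
  SimpleGraph.fromRel (fun x y => x.1 < y.1 ∧ σ x.1 y.1 x.2 = y.2)

/-- The proportion of `ℓ`-lifts of `K_n` (all chosen uniformly at random) whose lift
graph satisfies the property `p`. -/
noncomputable def liftProb (n ℓ : ℕ) (p : SimpleGraph (Fin n × Fin ℓ) → Prop) : ℝ :=
  ((@Finset.filter _ (fun σ : Fin n → Fin n → Equiv.Perm (Fin ℓ) => p (liftGraph n ℓ σ))
      (Classical.decPred _) Finset.univ).card : ℝ)
    / (Fintype.card (Fin n → Fin n → Equiv.Perm (Fin ℓ)) : ℝ)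

/-- `f : Fin m → V` is the family of branch vertices of a topological clique of order `m`
in `G`: `f` is injective and there are pairwise internally vertex-disjoint paths between
the branch vertices whose internal vertices avoid all branch vertices. -/
def HasTopCliqueFun {V : Type*} (G : SimpleGraph V) {m : ℕ} (f : Fin m → V) : Prop :=
  Function.Injective f ∧
  ∃ P : ∀ i j : Fin m, G.Walk (f i) (f j),
    (∀ i j : Fin m, i < j → (P i j).IsPath) ∧
    (∀ i j : Fin m, i < j → ∀ k : Fin m, f k ∉ (P i j).support.tail.dropLast) ∧
    (∀ i j i' j' : Fin m, i < j → i' < j' → (i, j) ≠ (i', j') →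
      ∀ x, x ∈ (P i j).support.tail.dropLast → x ∉ (P i' j').support.tail.dropLast)

/-- `G` contains a topological clique of order `m` (a subdivision of `K_m`). -/
def HasTopClique {V : Type*} (G : SimpleGraph V) (m : ℕ) : Prop :=
  ∃ f : Fin m → V, HasTopCliqueFun G f

/-- The Hajós number of `G`: the largest order of a topological clique in `G`. -/
noncomputable def hajosNumber {V : Type*} [Fintype V] (G : SimpleGraph V) : ℕ :=
  sSup {m | HasTopClique G m}

/-- The average of a real function on a finite type. -/
noncomputable def avg {Ω : Type*} [Fintype Ω] (f : Ω → ℝ) : ℝ :=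
  (∑ ω, f ω) / Fintype.card Ω

open Classical in
/-- The probability of a property under the uniform distribution on a finite type. -/
noncomputable def pr {Ω : Type*} [Fintype Ω] (p : Ω → Prop) : ℝ :=
  avg fun ω => if p ω then 1 else 0

section Average

variable {Ω Ω' ι κ α : Type*} [Fintype Ω] [Fintype Ω']

theorem avg_mono {f g : Ω → ℝ} (h : ∀ ω, f ω ≤ g ω) : avg f ≤ avg g := by
  unfold avg
  gcongr with ω
  exact h ω

theorem avg_nonneg {f : Ω → ℝ} (h : ∀ ω, 0 ≤ f ω) : 0 ≤ avg f :=
  div_nonneg (Finset.sum_nonneg fun ω _ => h ω) (Nat.cast_nonneg _)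

theorem avg_const [Nonempty Ω] (a : ℝ) : avg (fun _ : Ω => a) = a := by
  simp [avg]

theorem avg_mul_const (f : Ω → ℝ) (a : ℝ) : avg (fun ω => f ω * a) = avg f * a := by
  simp only [avg, ← Finset.sum_mul]; ring

theorem avg_const_mul (f : Ω → ℝ) (a : ℝ) : avg (fun ω => a * f ω) = a * avg f := by
  simp only [avg, ← Finset.mul_sum]; ring

theorem avg_add (f g : Ω → ℝ) : avg (fun ω => f ω + g ω) = avg f + avg g := by
  simp only [avg, Finset.sum_add_distrib, add_div]

theorem avg_sum (s : Finset ι) (f : ι → Ω → ℝ) :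
    avg (fun ω => ∑ i ∈ s, f i ω) = ∑ i ∈ s, avg (f i) := by
  simp only [avg]
  rw [Finset.sum_comm, Finset.sum_div]

theorem avg_comm (f : Ω → Ω' → ℝ) :
    avg (fun ω => avg (f ω)) = avg fun ω' => avg fun ω => f ω ω' := by
  simp only [avg, ← Finset.sum_div]
  rw [Finset.sum_comm, div_div, div_div, mul_comm (Fintype.card Ω : ℝ)]

theorem avg_comp_equiv (e : Ω ≃ Ω') (f : Ω' → ℝ) : avg (fun ω => f (e ω)) = avg f := by
  unfold avg
  rw [Fintype.card_congr e, Equiv.sum_comp e f]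

theorem avg_pi [Fintype ι] [DecidableEq ι] [Fintype α] (f : ι → α → ℝ) :
    avg (fun x : ι → α => ∏ i, f i (x i)) = ∏ i, avg (f i) := by
  simp only [avg, Finset.prod_div_distrib, Finset.prod_const, Finset.card_univ, Fintype.card_pi]
  rw [Finset.prod_univ_sum]
  simp

theorem avg_pi_finset [Fintype ι] [DecidableEq ι] [Fintype α] [Nonempty α] (s : Finset ι)
    (f : ι → α → ℝ) :
    avg (fun x : ι → α => ∏ i ∈ s, f i (x i)) = ∏ i ∈ s, avg (f i) := by
  have h := avg_pi fun i a => if i ∈ s then f i a else 1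
  have h' : ∀ i, avg (fun a => if i ∈ s then f i a else 1) = if i ∈ s then avg (f i) else 1 := by
    intro i
    split_ifs
    · rfl
    · exact avg_const 1
  simpa only [h', Finset.prod_ite_mem, Finset.univ_inter] using h

theorem avg_pi₂_finset [Fintype ι] [DecidableEq ι] [Fintype κ] [DecidableEq κ] [Fintype α]
    [Nonempty α] (s : Finset (ι × κ)) (f : ι → κ → α → ℝ) :
    avg (fun x : ι → κ → α => ∏ i ∈ s, f i.1 i.2 (x i.1 i.2)) = ∏ i ∈ s, avg (f i.1 i.2) := by
  have h := avg_pi_finset s fun i => f i.1 i.2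
  rw [← h, ← avg_comp_equiv (Equiv.curry ι κ α).symm]
  rfl

theorem pr_le_avg {p : Ω → Prop} {f : Ω → ℝ} (h₀ : ∀ ω, 0 ≤ f ω) (h₁ : ∀ ω, p ω → 1 ≤ f ω) :
    pr p ≤ avg f := by
  classical
  refine avg_mono fun ω => ?_
  split_ifs with h
  · exact h₁ ω h
  · exact h₀ ω

theorem pr_nonneg (p : Ω → Prop) : 0 ≤ pr p := by
  classical
  refine avg_nonneg fun ω => ?_
  split_ifs <;> norm_num

theorem pr_mono {p q : Ω → Prop} (h : ∀ ω, p ω → q ω) : pr p ≤ pr q := by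
  classical
  refine avg_mono fun ω => ?_
  by_cases hp : p ω
  · simp [hp, h ω hp]
  · simp only [hp, if_false]
    split_ifs <;> norm_num

theorem pr_or_le (p q : Ω → Prop) : pr (fun ω => p ω ∨ q ω) ≤ pr p + pr q := by
  classical
  simp only [pr, avg, ← add_div, ← Finset.sum_add_distrib]
  gcongr with ω
  by_cases hp : p ω <;> by_cases hq : q ω <;> simp [hp, hq]

theorem pr_exists_le (s : Finset ι) (p : ι → Ω → Prop) :
    pr (fun ω => ∃ i ∈ s, p i ω) ≤ ∑ i ∈ s, pr (p i) := by
  classical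
  refine (pr_le_avg (f := fun ω => ∑ i ∈ s, if p i ω then (1 : ℝ) else 0) ?_ ?_).trans
    (avg_sum s _).le
  · intro ω
    exact Finset.sum_nonneg fun i _ => by split_ifs <;> norm_num
  · rintro ω ⟨i, hi, h⟩
    refine le_trans (by simp [h]) (Finset.single_le_sum (f := fun i => if p i ω then (1 : ℝ) else 0)
      (fun i _ => by split_ifs <;> norm_num) hi)

theorem pr_exists_le_card_mul (s : Finset ι) (p : ι → Ω → Prop) {b : ℝ}
    (h : ∀ i ∈ s, pr (p i) ≤ b) : pr (fun ω => ∃ i ∈ s, p i ω) ≤ s.card * b :=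
  (pr_exists_le s p).trans <| (Finset.sum_le_card_nsmul s _ b h).trans_eq (nsmul_eq_mul _ _)

theorem one_sub_pr_not_le [Nonempty Ω] (p : Ω → Prop) : 1 - pr (fun ω => ¬ p ω) ≤ pr p := by
  have h : (1 : ℝ) ≤ pr fun ω => p ω ∨ ¬ p ω := by
    simp [pr, em, avg_const]
  linarith [pr_or_le p fun ω => ¬ p ω]

theorem pr_comp_equiv (e : Ω ≃ Ω') (p : Ω' → Prop) : pr (fun ω => p (e ω)) = pr p := by
  classical
  exact avg_comp_equiv e fun ω => if p ω then (1 : ℝ) else 0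

/-- Chernoff bound for a variable whose generating function is at most Poissonian. -/
theorem pr_le_of_avg_pow_le {X : Ω → ℕ} {μ η K s : ℝ} (hη : 0 < η) (hη' : η ≤ 1 / 2)
    (hμ : μ ≤ K / 2) (hK : 0 ≤ K) (hs : μ + η * K ≤ s)
    (h : ∀ x : ℝ, 0 < x → avg (fun ω => (1 + x) ^ X ω) ≤ Real.exp (x * μ)) :
    pr (fun ω => s ≤ X ω) ≤ Real.exp (-(η ^ 2 * K / 4)) := by
  set x := η / 2 with hx
  have hx0 : 0 < x := by positivity
  set θ := Real.log (1 + x) with hθ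
  have hθ0 : 0 ≤ θ := Real.log_nonneg (by linarith)
  have hθ1 : θ ≤ x := by
    have := Real.log_le_sub_one_of_pos (show 0 < 1 + x by linarith)
    linarith
  have hθ2 : x - x ^ 2 ≤ θ := by
    have h1 := Real.one_sub_inv_le_log_of_pos (show 0 < 1 + x by linarith)
    have h2 : (1 + x)⁻¹ ≤ 1 - x + x ^ 2 := by
      rw [inv_le_iff_one_le_mul₀ (by linarith)]
      nlinarith [pow_pos hx0 3]
    linarith
  have hpow : ∀ k : ℕ, (1 + x) ^ k = Real.exp (θ * k) := by
    intro k
    rw [mul_comm, Real.exp_nat_mul, Real.exp_log (by linarith)]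
  calc pr (fun ω => s ≤ X ω)
      ≤ avg fun ω => (1 + x) ^ X ω * Real.exp (-(θ * (μ + η * K))) := by
        refine pr_le_avg (fun ω => by positivity) fun ω hω => ?_
        rw [hpow, ← Real.exp_add, Real.one_le_exp_iff]
        nlinarith
    _ ≤ Real.exp (x * μ) * Real.exp (-(θ * (μ + η * K))) := by
        rw [avg_mul_const]
        gcongr
        exact h x hx0
    _ ≤ Real.exp (-(η ^ 2 * K / 4)) := by
        rw [← Real.exp_add]
        gcongr
        have h1 : (x - θ) * μ ≤ x ^ 2 * (K / 2) :=
          (mul_le_mul_of_nonneg_left hμ (by linarith)).trans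
            (mul_le_mul_of_nonneg_right (by linarith) (by linarith))
        have h2 : (x - x ^ 2) * (η * K) ≤ θ * (η * K) := by gcongr
        have h3 : x ^ 2 * (η * K) ≤ x ^ 2 * (K / 2) := by gcongr; nlinarith
        have h4 : η ^ 2 * K / 4 = x ^ 2 * K := by rw [hx]; ring
        have h5 : x * (η * K) = 2 * (x ^ 2 * K) := by rw [hx]; ring
        linarith

end Average

section RandomLift

variable {n ℓ : ℕ}

theorem avg_ite_eq {α : Type*} [Fintype α] [DecidableEq α] (a : α) :
    avg (fun b : α => if b = a then (1 : ℝ) else 0) = 1 / Fintype.card α := by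
  simp [avg]

theorem avg_ite_notMem {α : Type*} [Fintype α] [DecidableEq α] [Nonempty α] (s : Finset α) :
    avg (fun b : α => if b ∉ s then (1 : ℝ) else 0) = 1 - s.card / Fintype.card α := by
  have h : (Fintype.card α : ℝ) ≠ 0 := by simp
  rw [avg, Finset.sum_boole, ← Finset.compl_filter, Finset.card_compl, Finset.filter_univ_mem, Nat.cast_sub (Finset.card_le_univ s)]
  field_simp

/-- Evaluating the independent uniform permutations at `0` gives independent uniform values. -/
theorem avg_apply_zero [NeZero ℓ] {ι κ : Type*} [Fintype ι] [DecidableEq ι] [Fintype κ]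
    [DecidableEq κ] (F : (ι → κ → Fin ℓ) → ℝ) :
    avg (fun σ : ι → κ → Equiv.Perm (Fin ℓ) => F fun i j => σ i j 0) = avg F := by
  have h : ∀ x : ι → κ → Fin ℓ, avg (fun σ : ι → κ → Equiv.Perm (Fin ℓ) => F fun i j => σ i j 0) =
      avg fun σ : ι → κ → Equiv.Perm (Fin ℓ) => F fun i j => σ i j 0 + x i j := fun x =>
    (avg_comp_equiv (Equiv.piCongrRight fun i => Equiv.piCongrRight fun j =>
      Equiv.mulLeft (Equiv.addRight (x i j)))
      fun σ : ι → κ → Equiv.Perm (Fin ℓ) => F fun i j => σ i j 0).symm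
  calc _ = avg fun _ : ι → κ → Fin ℓ =>
        avg fun σ : ι → κ → Equiv.Perm (Fin ℓ) => F fun i j => σ i j 0 := (avg_const _).symm
    _ = avg fun x : ι → κ → Fin ℓ =>
        avg fun σ : ι → κ → Equiv.Perm (Fin ℓ) => F fun i j => σ i j 0 + x i j := by
      congr 1; funext x; exact h x
    _ = avg fun σ : ι → κ → Equiv.Perm (Fin ℓ) =>
        avg fun x : ι → κ → Fin ℓ => F fun i j => σ i j 0 + x i j := avg_comm _
    _ = avg fun _ : ι → κ → Equiv.Perm (Fin ℓ) => avg F := by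
      congr 1; funext σ
      exact avg_comp_equiv (Equiv.addLeft fun i j => σ i j 0) F
    _ = avg F := avg_const _

theorem pr_apply_zero [NeZero ℓ] {ι κ : Type*} [Fintype ι] [DecidableEq ι] [Fintype κ]
    [DecidableEq κ] (p : (ι → κ → Fin ℓ) → Prop) :
    pr (fun σ : ι → κ → Equiv.Perm (Fin ℓ) => p fun i j => σ i j 0) = pr p := by
  classical
  exact avg_apply_zero fun x => if p x then (1 : ℝ) else 0

theorem pow_card_filter_eq_prod {α : Type*} (s : Finset α) (p : α → Prop) [DecidablePred p]
    (x : ℝ) : x ^ (s.filter p).card = ∏ a ∈ s, if p a then x else 1 := by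
  rw [Finset.prod_ite]; simp

/-- Chernoff bound for the number of pairs in `Q` whose fibers are not joined at level `0`. -/
theorem pr_le_card_ne_zero [NeZero ℓ] (Q : Finset (Fin n × Fin n)) {K η : ℝ} (hη : 0 < η)
    (hη' : η ≤ 1 / 2) (hQ : (Q.card : ℝ) ≤ K / 2) :
    pr (fun σ : Fin n → Fin n → Equiv.Perm (Fin ℓ) =>
      K / 2 * (1 - 1 / ℓ) + η * K ≤ (Q.filter fun q => σ q.1 q.2 0 ≠ 0).card) ≤
      Real.exp (-(η ^ 2 * K / 4)) := by
  have hQ0 : (0 : ℝ) ≤ Q.card := Nat.cast_nonneg _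
  have hℓ : (1 : ℝ) ≤ ℓ := by exact_mod_cast NeZero.one_le
  have hq : 0 ≤ 1 - 1 / (ℓ : ℝ) := by
    rw [sub_nonneg, div_le_one (by linarith)]; exact hℓ
  have hq' : 1 - 1 / (ℓ : ℝ) ≤ 1 := by
    have : 0 ≤ 1 / (ℓ : ℝ) := by positivity
    linarith
  rw [pr_apply_zero fun y => K / 2 * (1 - 1 / ℓ) + η * K ≤ (Q.filter fun q => y q.1 q.2 ≠ 0).card]
  refine pr_le_of_avg_pow_le (μ := K / 2 * (1 - 1 / ℓ)) hη hη' ?_ (by linarith) le_rfl ?_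
  · nlinarith
  · intro x hx
    simp only [pow_card_filter_eq_prod]
    rw [avg_pi₂_finset Q fun _ _ (b : Fin ℓ) => if b ≠ 0 then 1 + x else 1]
    have h : avg (fun b : Fin ℓ => if b ≠ 0 then 1 + x else 1) = 1 + x * (1 - 1 / ℓ) := by
      have h1 := avg_ite_notMem ({0} : Finset (Fin ℓ))
      have h2 : (fun b : Fin ℓ => if b ≠ 0 then 1 + x else 1) =
          fun b => 1 + x * if b ∉ ({0} : Finset (Fin ℓ)) then (1 : ℝ) else 0 := by
        funext b
        by_cases hb : b = 0 <;> simp [hb]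
      rw [h2, avg_add, avg_const, avg_const_mul, h1]
      simp
    rw [h, Finset.prod_const]
    calc (1 + x * (1 - 1 / ℓ)) ^ Q.card ≤ Real.exp (x * (1 - 1 / ℓ)) ^ Q.card := by
          gcongr
          linarith [Real.add_one_le_exp (x * (1 - 1 / (ℓ : ℝ)))]
      _ = Real.exp (Q.card * (x * (1 - 1 / ℓ))) := (Real.exp_nat_mul _ _).symm
      _ ≤ _ := by
          rw [mul_left_comm]
          gcongr

end RandomLift

section PermutationEdges

variable {n ℓ : ℕ} {α : Type*} [Fintype α] [DecidableEq α]

/-- The event that a uniform permutation maps `K` into `B` is at most as likely as for independent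
uniform values. -/
theorem avg_perm_mapsTo_le (B K : Finset α) :
    avg (fun π : Equiv.Perm α => if ∀ a ∈ K, π a ∈ B then (1 : ℝ) else 0) ≤
      ((B.card : ℝ) / Fintype.card α) ^ K.card := by
  induction K using Finset.induction_on with
  | empty => simp [avg_const]
  | insert a K ha ih =>
    set p : Finset α → ℝ := fun K =>
      avg fun π : Equiv.Perm α => if ∀ a ∈ K, π a ∈ B then (1 : ℝ) else 0 with hp
    have hsymm : ∀ a' ∈ Kᶜ, p (insert a' K) = p (insert a K) := by
      intro a' ha'
      rw [Finset.mem_compl] at ha'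
      simp only [hp]
      rw [← avg_comp_equiv (Equiv.mulRight (Equiv.swap a a'))]
      congr 1
      funext π
      congr 1
      simp only [Equiv.coe_mulRight, Equiv.Perm.coe_mul, Function.comp_apply, eq_iff_iff,
        Finset.forall_mem_insert, Equiv.swap_apply_right]
      refine and_congr Iff.rfl (forall₂_congr fun b hb => ?_)
      rw [Equiv.swap_apply_of_ne_of_ne (by rintro rfl; exact ha hb) (by rintro rfl; exact ha' hb)]
    have hk : (K.card : ℝ) < Fintype.card α := by
      exact_mod_cast (Finset.card_lt_univ_of_notMem ha)
    have hb : (B.card : ℝ) ≤ Fintype.card α := by exact_mod_cast Finset.card_le_univ B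
    have hsum : ((Fintype.card α : ℝ) - K.card) * p (insert a K) = (B.card - K.card) * p K := by
      have h1 : ∑ a' ∈ Kᶜ, p (insert a' K) = (Fintype.card α - K.card) * p (insert a K) := by
        rw [Finset.sum_congr rfl hsymm, Finset.sum_const, Finset.card_compl, nsmul_eq_mul,
          Nat.cast_sub (Finset.card_le_univ K)]
      rw [← h1]
      simp only [hp]
      rw [← avg_sum, ← avg_const_mul]
      congr 1
      funext π
      by_cases hπ : ∀ a ∈ K, π a ∈ B
      · have h2 : ∀ a', (if ∀ a ∈ insert a' K, π a ∈ B then (1 : ℝ) else 0) =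
            if π a' ∈ B then 1 else 0 := by
          intro a'
          simp only [Finset.forall_mem_insert, and_iff_left hπ]
        rw [Finset.sum_congr rfl fun a' _ => h2 a', Finset.sum_boole, if_pos hπ, mul_one]
        have h3 : Kᶜ.filter (fun a' => π a' ∈ B) = (B.map π.symm.toEmbedding) \ K := by
          ext b
          simp only [Finset.mem_filter, Finset.mem_compl, Finset.mem_sdiff, Finset.mem_map_equiv,
            Equiv.symm_symm]
          tauto
        have h4 : K ⊆ B.map π.symm.toEmbedding := by
          intro b hb
          simpa only [Finset.mem_map_equiv, Equiv.symm_symm] using hπ b hb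
        rw [h3, Finset.card_sdiff_of_subset h4, Nat.cast_sub (Finset.card_le_card h4),
          Finset.card_map]
      · rw [if_neg hπ, mul_zero]
        refine Finset.sum_eq_zero fun a' _ => if_neg fun h => hπ fun b hb =>
          h b (Finset.mem_insert_of_mem hb)
    have hpK : 0 ≤ p K := avg_nonneg fun π => by split_ifs <;> norm_num
    have hα : (0 : ℝ) < Fintype.card α := lt_of_le_of_lt (Nat.cast_nonneg _) hk
    have hle : p (insert a K) ≤ B.card / Fintype.card α * p K := by
      rw [div_mul_eq_mul_div, le_div_iff₀ hα]
      have h5 : 0 ≤ (K.card : ℝ) * (Fintype.card α - B.card) * p K :=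
        mul_nonneg (mul_nonneg (Nat.cast_nonneg _) (by linarith)) hpK
      refine le_of_mul_le_mul_left ?_ (sub_pos.2 hk)
      linear_combination h5 + (Fintype.card α : ℝ) * hsum
    rw [Finset.card_insert_of_notMem ha, pow_succ']
    exact hle.trans (mul_le_mul_of_nonneg_left ih (by positivity))

theorem avg_perm_prod_le (A B : Finset α) {x : ℝ} (hx : 0 ≤ x) :
    avg (fun π : Equiv.Perm α => ∏ a ∈ A, if π a ∈ B then 1 + x else 1) ≤
      Real.exp (x * (A.card * B.card / Fintype.card α)) := by
  have h : ∀ π : Equiv.Perm α, (∏ a ∈ A, if π a ∈ B then 1 + x else 1) =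
      ∑ K ∈ A.powerset, x ^ K.card * if ∀ a ∈ K, π a ∈ B then (1 : ℝ) else 0 := by
    intro π
    have h1 : ∀ a ∈ A, (if π a ∈ B then 1 + x else 1) = 1 + if π a ∈ B then x else 0 := by
      intro a _
      split_ifs <;> simp
    rw [Finset.prod_congr rfl h1, Finset.prod_one_add]
    refine Finset.sum_congr rfl fun K _ => ?_
    split_ifs with hK
    · rw [Finset.prod_congr rfl fun a ha => if_pos (hK a ha), Finset.prod_const, mul_one]
    · push Not at hK
      obtain ⟨a, ha, hab⟩ := hK
      rw [mul_zero]
      exact Finset.prod_eq_zero ha (if_neg hab)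
  simp only [h]
  rw [avg_sum]
  calc _ ≤ ∑ K ∈ A.powerset, (x * (B.card / Fintype.card α)) ^ K.card := by
        refine Finset.sum_le_sum fun K _ => ?_
        rw [avg_const_mul, mul_pow]
        gcongr
        exact avg_perm_mapsTo_le B K
    _ = (1 + x * (B.card / Fintype.card α)) ^ A.card := by
        rw [← Finset.prod_const, Finset.prod_one_add]
        simp
    _ ≤ Real.exp (x * (B.card / Fintype.card α)) ^ A.card := by
        gcongr
        rw [add_comm]
        exact Real.add_one_le_exp _
    _ = _ := by
        rw [← Real.exp_nat_mul]
        congr 1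
        ring

/-- The edges of the lift inside `S`, oriented towards the larger fiber. -/
def liftEdges (σ : Fin n → Fin n → Equiv.Perm (Fin ℓ)) (S : Finset (Fin n × Fin ℓ)) :
    Finset ((Fin n × Fin ℓ) × (Fin n × Fin ℓ)) :=
  (S ×ˢ S).filter fun e => e.1.1 < e.2.1 ∧ σ e.1.1 e.2.1 e.1.2 = e.2.2

theorem card_liftEdges (σ : Fin n → Fin n → Equiv.Perm (Fin ℓ)) (S : Finset (Fin n × Fin ℓ)) :
    (liftEdges σ S).card = ∑ q ∈ (Finset.univ : Finset (Fin n × Fin n)).filter (fun q => q.1 < q.2),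
      ((Finset.univ.filter fun a => (q.1, a) ∈ S).filter
        fun a => σ q.1 q.2 a ∈ Finset.univ.filter fun b => (q.2, b) ∈ S).card := by
  rw [Finset.card_eq_sum_card_fiberwise (f := fun e => (e.1.1, e.2.1))
    (t := (Finset.univ : Finset (Fin n × Fin n)).filter (fun q => q.1 < q.2))]
  · refine Finset.sum_congr rfl fun q hq => ?_
    rw [Finset.mem_filter] at hq
    refine Finset.card_bij' (fun e _ => e.1.2) (fun a _ => ((q.1, a), (q.2, σ q.1 q.2 a)))
      ?_ ?_ ?_ ?_
    · rintro ⟨⟨i, a⟩, ⟨j, b⟩⟩ he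
      simp only [liftEdges, Finset.mem_filter, Finset.mem_product] at he
      obtain ⟨⟨⟨h1, h2⟩, -, h3⟩, rfl⟩ := he
      subst h3
      simpa using ⟨h1, h2⟩
    · intro a ha
      simpa [liftEdges, hq.2] using ha
    · rintro ⟨⟨i, a⟩, ⟨j, b⟩⟩ he
      simp only [liftEdges, Finset.mem_filter, Finset.mem_product] at he
      obtain ⟨⟨⟨h1, h2⟩, -, h3⟩, rfl⟩ := he
      subst h3
      rfl
    · intro a _
      rfl
  · intro e he
    simp only [liftEdges, Finset.coe_filter, Set.mem_ofPred_eq] at he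
    simpa using he.2.1

theorem sum_card_fibers_mul_le (S : Finset (Fin n × Fin ℓ)) :
    ∑ q ∈ (Finset.univ : Finset (Fin n × Fin n)).filter (fun q => q.1 < q.2),
      ((Finset.univ.filter fun a => (q.1, a) ∈ S).card : ℝ) *
        (Finset.univ.filter fun b => (q.2, b) ∈ S).card ≤ (S.card : ℝ) ^ 2 / 2 := by
  set s : Fin n → ℝ := fun i => (Finset.univ.filter fun a => (i, a) ∈ S).card with hs
  have hS : ∑ i, s i = S.card := by
    rw [Finset.card_eq_sum_card_fiberwise (f := Prod.fst) (t := Finset.univ) (by simp)]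
    push_cast
    refine Finset.sum_congr rfl fun i _ => ?_
    simp only [hs]
    congr 1
    refine Finset.card_bij' (fun a _ => (i, a)) (fun p _ => p.2) ?_ ?_ ?_ ?_
    · intro a ha; simpa using ha
    · rintro ⟨j, a⟩ h
      simp only [Finset.mem_filter] at h
      obtain ⟨h, rfl⟩ := h
      simpa using h
    · intro a _; rfl
    · rintro ⟨j, a⟩ h
      simp only [Finset.mem_filter] at h
      obtain ⟨h, rfl⟩ := h
      rfl
  have hs0 : ∀ i, 0 ≤ s i := fun i => Nat.cast_nonneg _
  have hsq : (S.card : ℝ) ^ 2 = ∑ q : Fin n × Fin n, s q.1 * s q.2 := by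
    rw [← hS, sq, Finset.sum_mul_sum, Fintype.sum_prod_type]
  have hswap : ∑ q ∈ (Finset.univ : Finset (Fin n × Fin n)).filter (fun q => q.2 < q.1),
      s q.1 * s q.2 = ∑ q ∈ (Finset.univ : Finset (Fin n × Fin n)).filter (fun q => q.1 < q.2),
      s q.1 * s q.2 := by
    refine Finset.sum_nbij' Prod.swap Prod.swap ?_ ?_ ?_ ?_ ?_ <;> simp [mul_comm]
  have hdisj : Disjoint ((Finset.univ : Finset (Fin n × Fin n)).filter fun q => q.1 < q.2)
      (Finset.univ.filter fun q => q.2 < q.1) :=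
    Finset.disjoint_filter.2 fun q _ h => h.asymm
  have hle := Finset.sum_le_sum_of_subset_of_nonneg (f := fun q : Fin n × Fin n => s q.1 * s q.2)
    (Finset.subset_univ (((Finset.univ : Finset (Fin n × Fin n)).filter fun q => q.1 < q.2) ∪
      (Finset.univ.filter fun q => q.2 < q.1))) fun q _ _ => mul_nonneg (hs0 _) (hs0 _)
  rw [Finset.sum_union hdisj, hswap, ← hsq] at hle
  linarith

/-- Chernoff bound for the number of edges of a random lift inside a fixed vertex set. -/
theorem pr_le_card_liftEdges (hℓ : 1 ≤ ℓ) (S : Finset (Fin n × Fin ℓ)) {η : ℝ} (hη : 0 < η)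
    (hη' : η ≤ 1 / 2) :
    pr (fun σ => (S.card : ℝ) ^ 2 / 2 / ℓ + η * (S.card : ℝ) ^ 2 ≤ (liftEdges σ S).card) ≤
      Real.exp (-(η ^ 2 * (S.card : ℝ) ^ 2 / 4)) := by
  have hℓ' : (1 : ℝ) ≤ ℓ := by exact_mod_cast hℓ
  refine pr_le_of_avg_pow_le hη hη' (div_le_self (by positivity) hℓ') (by positivity) le_rfl ?_
  intro x hx
  simp only [card_liftEdges, ← Finset.prod_pow_eq_pow_sum, pow_card_filter_eq_prod]
  rw [avg_pi₂_finset _ fun i j (π : Equiv.Perm (Fin ℓ)) =>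
    ∏ a ∈ Finset.univ.filter fun a => (i, a) ∈ S,
      if π a ∈ Finset.univ.filter fun b => (j, b) ∈ S then 1 + x else 1]
  calc _ ≤ ∏ q ∈ (Finset.univ : Finset (Fin n × Fin n)).filter (fun q => q.1 < q.2),
        Real.exp (x * ((Finset.univ.filter fun a => (q.1, a) ∈ S).card *
          (Finset.univ.filter fun b => (q.2, b) ∈ S).card / ℓ)) := by
        refine Finset.prod_le_prod (fun q _ => avg_nonneg fun π => ?_) fun q _ => ?_
        · exact Finset.prod_nonneg fun a _ => by split_ifs <;> positivity
        · simpa only [Fintype.card_fin] using avg_perm_prod_le (α := Fin ℓ) _ _ hx.le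
    _ ≤ _ := by
        rw [← Real.exp_sum, ← Finset.mul_sum, ← Finset.sum_div]
        gcongr
        exact sum_card_fibers_mul_le S

end PermutationEdges

section Connections

variable {n ℓ : ℕ}

/-- Conjugating the permutations of `J₁ ×ˢ J₂` so that the lifts of `u` and `v` take over the role
of level `0`. -/
noncomputable def alignLevels [NeZero ℓ] (u v : Fin n) (J₁ J₂ : Finset (Fin n))
    (σ : Fin n → Fin n → Equiv.Perm (Fin ℓ)) : Fin n → Fin n → Equiv.Perm (Fin ℓ) :=
  fun j k => if j ∈ J₁ ∧ k ∈ J₂ then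
    Equiv.swap 0 (σ v k 0) * σ j k * Equiv.swap 0 (σ u j 0) else σ j k

theorem alignLevels_involutive [NeZero ℓ] {u v : Fin n} {J₁ J₂ : Finset (Fin n)} (hu : u ∉ J₁)
    (hv : v ∉ J₁) : Function.Involutive (alignLevels (ℓ := ℓ) u v J₁ J₂) := by
  intro σ
  funext j k
  by_cases h : j ∈ J₁ ∧ k ∈ J₂
  · simp [alignLevels, h, hu, hv, mul_assoc]
  · simp [alignLevels, h]

theorem pr_no_connection_le [NeZero ℓ] {u v : Fin n} {J₁ J₂ : Finset (Fin n)} (hu : u ∉ J₁)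
    (hv : v ∉ J₁) :
    pr (fun σ : Fin n → Fin n → Equiv.Perm (Fin ℓ) =>
      ∀ j ∈ J₁, ∀ k ∈ J₂, σ j k (σ u j 0) ≠ σ v k 0) ≤
      Real.exp (-(J₁.card * J₂.card / ℓ : ℝ)) := by
  have hℓ : (1 : ℝ) ≤ ℓ := by exact_mod_cast NeZero.one_le
  rw [← pr_comp_equiv (alignLevels_involutive (J₂ := J₂) hu hv).toPerm]
  calc _ ≤ pr fun σ : Fin n → Fin n → Equiv.Perm (Fin ℓ) =>
        ∀ q ∈ J₁ ×ˢ J₂, σ q.1 q.2 0 ≠ 0 := by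
        refine pr_mono fun σ h => ?_
        rintro ⟨j, k⟩ hjk h0
        rw [Finset.mem_product] at hjk
        refine h j hjk.1 k hjk.2 ?_
        simp only at h0
        simp [alignLevels, hjk.1, hjk.2, hu, hv, h0]
    _ = pr fun y : Fin n → Fin n → Fin ℓ => ∀ q ∈ J₁ ×ˢ J₂, y q.1 q.2 ≠ 0 :=
        pr_apply_zero fun y => ∀ q ∈ J₁ ×ˢ J₂, y q.1 q.2 ≠ 0
    _ ≤ avg fun y : Fin n → Fin n → Fin ℓ =>
        ∏ q ∈ J₁ ×ˢ J₂, if y q.1 q.2 ∉ ({0} : Finset (Fin ℓ)) then (1 : ℝ) else 0 := by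
        refine pr_le_avg (fun y => Finset.prod_nonneg fun q _ => by split_ifs <;> norm_num)
          fun y hy => ?_
        rw [Finset.prod_congr rfl fun q hq => if_pos (by simpa using hy q hq)]
        simp
    _ = (1 - 1 / ℓ : ℝ) ^ (J₁.card * J₂.card) := by
        rw [avg_pi₂_finset _ fun _ _ (b : Fin ℓ) => if b ∉ ({0} : Finset (Fin ℓ)) then (1 : ℝ) else 0,
          avg_ite_notMem, Finset.prod_const, Finset.card_product]
        simp
    _ ≤ Real.exp (-(1 / ℓ)) ^ (J₁.card * J₂.card) := by
        gcongr
        · rw [sub_nonneg, div_le_one (by linarith)]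
          exact hℓ
        · exact Real.one_sub_le_exp_neg _
    _ = _ := by
        rw [← Real.exp_nat_mul]
        congr 1
        push_cast
        ring

/-- With high probability, the neighbours of `u` and `v` in any two large sets of fibers inside
`R₁` and `R₂` are joined by an edge. -/
theorem pr_exists_no_connection_le [NeZero ℓ] {U R₁ R₂ : Finset (Fin n)} {r : ℕ}
    (hR₁ : R₁.card = r) (hR₂ : R₂.card = r) (hU : Disjoint U R₁) :
    pr (fun σ : Fin n → Fin n → Equiv.Perm (Fin ℓ) =>
      ∃ u ∈ U, ∃ v ∈ U, ∃ J₁ ⊆ R₁, ∃ J₂ ⊆ R₂, r ≤ 2 * J₁.card ∧ r ≤ 2 * J₂.card ∧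
        ∀ j ∈ J₁, ∀ k ∈ J₂, σ j k (σ u j 0) ≠ σ v k 0) ≤
      (U.card : ℝ) ^ 2 * 4 ^ r * Real.exp (-((r : ℝ) ^ 2 / 4 / ℓ)) := by
  set I := (U ×ˢ U) ×ˢ (R₁.powerset.filter fun J => r ≤ 2 * J.card) ×ˢ
    (R₂.powerset.filter fun J => r ≤ 2 * J.card) with hI
  have hcard : (I.card : ℝ) ≤ (U.card : ℝ) ^ 2 * 4 ^ r := by
    have h1 := Finset.card_filter_le R₁.powerset fun J => r ≤ 2 * J.card
    have h2 := Finset.card_filter_le R₂.powerset fun J => r ≤ 2 * J.card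
    rw [Finset.card_powerset, hR₁] at h1
    rw [Finset.card_powerset, hR₂] at h2
    have h3 : I.card ≤ U.card ^ 2 * 4 ^ r := by
      rw [hI, Finset.card_product, Finset.card_product, Finset.card_product, ← sq,
        show 4 = 2 * 2 from rfl, mul_pow]
      gcongr
    exact_mod_cast h3
  calc _ ≤ pr fun σ : Fin n → Fin n → Equiv.Perm (Fin ℓ) =>
        ∃ i ∈ I, ∀ j ∈ i.2.1, ∀ k ∈ i.2.2, σ j k (σ i.1.1 j 0) ≠ σ i.1.2 k 0 := by
        refine pr_mono ?_
        rintro σ ⟨u, hu, v, hv, J₁, hJ₁, J₂, hJ₂, h₁, h₂, h⟩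
        refine ⟨((u, v), (J₁, J₂)), ?_, h⟩
        simp [hI, hu, hv, hJ₁, hJ₂, h₁, h₂]
    _ ≤ I.card * Real.exp (-((r : ℝ) ^ 2 / 4 / ℓ)) := by
        refine pr_exists_le_card_mul _ _ fun i hi => ?_
        simp only [hI, Finset.mem_product, Finset.mem_filter, Finset.mem_powerset] at hi
        obtain ⟨⟨hu, hv⟩, ⟨hJ₁, h₁⟩, hJ₂, h₂⟩ := hi
        refine (pr_no_connection_le (fun h => Finset.disjoint_left.1 hU hu (hJ₁ h))
          fun h => Finset.disjoint_left.1 hU hv (hJ₁ h)).trans ?_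
        have h₁' : (r : ℝ) ≤ 2 * i.2.1.card := by exact_mod_cast h₁
        have h₂' : (r : ℝ) ≤ 2 * i.2.2.card := by exact_mod_cast h₂
        gcongr
        nlinarith [mul_le_mul h₁' h₂' (Nat.cast_nonneg _) (by positivity)]
    _ ≤ _ := by gcongr

/-- The number of pairs in `U` with a common neighbour, counted with multiplicity over the
fibers in `R`. -/
def codegreeSum [NeZero ℓ] (U R : Finset (Fin n)) (σ : Fin n → Fin n → Equiv.Perm (Fin ℓ)) : ℕ :=
  ∑ j ∈ R, ((U ×ˢ U).filter fun q => σ q.1 j 0 = σ q.2 j 0).card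

theorem avg_ite_eq_apply_le [NeZero ℓ] (u v j : Fin n) :
    avg (fun y : Fin n → Fin n → Fin ℓ => if y u j = y v j then (1 : ℝ) else 0) ≤
      (if u = v then 1 else 0) + 1 / ℓ := by
  have hℓ : (ℓ : ℝ) ≠ 0 := by exact_mod_cast NeZero.ne ℓ
  by_cases huv : u = v
  · simp [huv, avg_const]
  · rw [if_neg huv, zero_add]
    have h : ∀ y : Fin n → Fin n → Fin ℓ, (if y u j = y v j then (1 : ℝ) else 0) =
        ∑ b, ∏ q ∈ ({(u, j), (v, j)} : Finset (Fin n × Fin n)),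
          if y q.1 q.2 = b then (1 : ℝ) else 0 := by
      intro y
      have : ∀ b, (∏ q ∈ ({(u, j), (v, j)} : Finset (Fin n × Fin n)),
          if y q.1 q.2 = b then (1 : ℝ) else 0) =
          if y u j = b then (if y v j = b then (1 : ℝ) else 0) else 0 := by
        intro b
        rw [Finset.prod_pair (by simp [huv]), ite_zero_mul_ite_zero, mul_one, ite_and]
      simp only [this]
      simp [eq_comm]
    simp only [h]
    rw [avg_sum]
    have h' : ∀ b : Fin ℓ, avg (fun y : Fin n → Fin n → Fin ℓ =>
        ∏ q ∈ ({(u, j), (v, j)} : Finset (Fin n × Fin n)),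
          if y q.1 q.2 = b then (1 : ℝ) else 0) = 1 / ℓ * (1 / ℓ) := by
      intro b
      rw [avg_pi₂_finset _ fun _ _ (a : Fin ℓ) => if a = b then (1 : ℝ) else 0,
        Finset.prod_pair (by simp [huv]), avg_ite_eq, Fintype.card_fin]
    simp only [h', Finset.sum_const, Finset.card_univ, Fintype.card_fin, nsmul_eq_mul]
    field_simp
    rfl

theorem pr_le_codegreeSum [NeZero ℓ] (U R : Finset (Fin n)) {s : ℝ} (hs : 0 < s) :
    pr (fun σ : Fin n → Fin n → Equiv.Perm (Fin ℓ) => s ≤ codegreeSum U R σ) ≤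
      R.card * (U.card + (U.card : ℝ) ^ 2 / ℓ) / s := by
  calc _ ≤ avg fun σ : Fin n → Fin n → Equiv.Perm (Fin ℓ) => (codegreeSum U R σ : ℝ) * s⁻¹ := by
        refine pr_le_avg (fun σ => by positivity) fun σ h => ?_
        rwa [← div_eq_mul_inv, one_le_div hs]
    _ = (∑ j ∈ R, ∑ q ∈ U ×ˢ U,
        avg fun y : Fin n → Fin n → Fin ℓ => if y q.1 j = y q.2 j then (1 : ℝ) else 0) * s⁻¹ := by
        rw [avg_mul_const]
        congr 1
        simp only [codegreeSum, Nat.cast_sum, Finset.card_filter, Nat.cast_ite, Nat.cast_one,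
          Nat.cast_zero]
        rw [avg_apply_zero fun y : Fin n → Fin n → Fin ℓ =>
          ∑ j ∈ R, ∑ q ∈ U ×ˢ U, if y q.1 j = y q.2 j then (1 : ℝ) else 0, avg_sum]
        refine Finset.sum_congr rfl fun j _ => ?_
        rw [avg_sum]
    _ ≤ (∑ j ∈ R, ∑ q ∈ U ×ˢ U, ((if q.1 = q.2 then 1 else 0) + 1 / (ℓ : ℝ))) * s⁻¹ := by
        gcongr
        exact avg_ite_eq_apply_le _ _ _
    _ = _ := by
        rw [Finset.sum_const, nsmul_eq_mul, Finset.sum_add_distrib, Finset.sum_product]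
        simp only [Finset.sum_ite_eq, Finset.sum_const, Finset.card_product, nsmul_eq_mul]
        rw [Finset.sum_congr rfl fun u hu => if_pos hu]
        simp
        ring

end Connections

section Coloring

variable {ι α : Type*} [Fintype α]

theorem avg_prod {Ω Ω' : Type*} [Fintype Ω] [Fintype Ω'] (f : Ω × Ω' → ℝ) :
    avg f = avg fun ω => avg fun ω' => f (ω, ω') := by
  simp only [avg, Fintype.sum_prod_type, Fintype.card_prod, Nat.cast_mul, ← Finset.sum_div]
  rw [div_div, mul_comm]

/-- Resampling the coordinates in `Y` does not change averages. -/
theorem avg_piecewise [Fintype ι] [DecidableEq ι] [Nonempty α] (Y : Finset ι) (H : (ι → α) → ℝ) :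
    avg (fun y => avg fun z => H (Y.piecewise z y)) = avg H := by
  have hinv : Function.Involutive fun p : (ι → α) × (ι → α) =>
      (Y.piecewise p.2 p.1, Y.piecewise p.1 p.2) := by
    rintro ⟨y, z⟩
    refine Prod.ext ?_ ?_ <;> funext i <;> by_cases hi : i ∈ Y <;> simp [hi]
  rw [← avg_prod fun p : (ι → α) × (ι → α) => H (Y.piecewise p.2 p.1)]
  refine (avg_comp_equiv hinv.toPerm fun p : (ι → α) × (ι → α) => H p.1).trans ?_
  rw [avg_prod]
  simp only [avg_const]

theorem prod_le_avg_pow {s : Finset ι} {a : ι → ℝ} (ha : ∀ i ∈ s, 0 ≤ a i) (hs : s.Nonempty) :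
    ∏ i ∈ s, a i ≤ ∑ i ∈ s, (s.card : ℝ)⁻¹ * a i ^ s.card := by
  have hc : (s.card : ℝ) ≠ 0 := by exact_mod_cast hs.card_pos.ne'
  have h := Real.geom_mean_le_arith_mean_weighted s (fun _ => (s.card : ℝ)⁻¹)
    (fun i => a i ^ s.card) (fun _ _ => by positivity) (by simp [hc])
    fun i hi => pow_nonneg (ha i hi) _
  refine le_of_eq_of_le (Finset.prod_congr rfl fun i hi => ?_) h
  rw [Real.pow_rpow_inv_natCast (ha i hi) hs.card_pos.ne']

theorem one_sub_card_div_nonneg (s : Finset α) : 0 ≤ 1 - (s.card : ℝ) / Fintype.card α := by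
  rw [sub_nonneg]
  exact div_le_one_of_le₀ (by exact_mod_cast Finset.card_le_univ s) (Nat.cast_nonneg _)

theorem one_sub_card_div_pow_le (s : Finset α) {k l : ℕ} (h : k ≤ l) :
    (1 - (s.card : ℝ) / Fintype.card α) ^ l ≤ Real.exp (-(k * s.card / Fintype.card α : ℝ)) := by
  have h1 : 1 - (s.card : ℝ) / Fintype.card α ≤ 1 := by
    have : 0 ≤ (s.card : ℝ) / Fintype.card α := by positivity
    linarith
  refine (pow_le_pow_of_le_one (one_sub_card_div_nonneg s) h1 h).trans ?_
  refine (pow_le_pow_left₀ (one_sub_card_div_nonneg s) (Real.one_sub_le_exp_neg _) k).trans_eq ?_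
  rw [← Real.exp_nat_mul]
  congr 1
  ring

theorem avg_one_sub_card_image_pow_le [Fintype ι] [DecidableEq ι] [DecidableEq α] [Nonempty α]
    (N : Finset ι) (T : Finset α) {k : ℕ}
    (hk : k ≤ N.card) :
    avg (fun y : ι → α => (1 - ((T ∩ N.image y).card : ℝ) / Fintype.card α) ^ k) ≤
      2 ^ T.card * Real.exp (-(k * T.card / Fintype.card α : ℝ)) := by
  calc _ ≤ avg fun y : ι → α => ∑ T' ∈ T.powerset, (∏ u ∈ N, if y u ∉ T' then (1 : ℝ) else 0) *
        (1 - ((T \ T').card : ℝ) / Fintype.card α) ^ k := by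
        refine avg_mono fun y => ?_
        have h := Finset.single_le_sum (s := T.powerset)
          (f := fun T' => (∏ u ∈ N, if y u ∉ T' then (1 : ℝ) else 0) *
            (1 - ((T \ T').card : ℝ) / Fintype.card α) ^ k)
          (fun T' _ => mul_nonneg (Finset.prod_nonneg fun u _ => by split_ifs <;> norm_num)
            (pow_nonneg (one_sub_card_div_nonneg _) _))
          (Finset.mem_powerset.2 (Finset.sdiff_subset (s := T) (t := N.image y)))
        refine le_of_eq_of_le ?_ h
        rw [sdiff_sdiff_right_self, Finset.inf_eq_inter, Finset.prod_congr rfl fun u hu => if_pos ?_]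
        · simp
        · simp only [Finset.mem_sdiff, not_and, not_not]
          exact fun _ => Finset.mem_image_of_mem y hu
    _ ≤ ∑ T' ∈ T.powerset, Real.exp (-(k * T'.card / Fintype.card α : ℝ)) *
        Real.exp (-(k * (T \ T').card / Fintype.card α : ℝ)) := by
        rw [avg_sum]
        refine Finset.sum_le_sum fun T' _ => ?_
        rw [avg_mul_const]
        refine mul_le_mul ?_ (one_sub_card_div_pow_le _ le_rfl)
          (pow_nonneg (one_sub_card_div_nonneg _) _) (Real.exp_nonneg _)
        rw [avg_pi_finset N fun _ (b : α) => if b ∉ T' then (1 : ℝ) else 0, avg_ite_notMem,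
          Finset.prod_const]
        exact one_sub_card_div_pow_le _ hk
    _ = ∑ T' ∈ T.powerset, Real.exp (-(k * T.card / Fintype.card α : ℝ)) := by
        refine Finset.sum_congr rfl fun T' hT' => ?_
        rw [← Real.exp_add]
        congr 1
        have h := Finset.card_sdiff_add_card_eq_card (Finset.mem_powerset.1 hT')
        have h' : (T.card : ℝ) = (T \ T').card + T'.card := by exact_mod_cast h.symm
        rw [h']
        ring
    _ = _ := by simp

/-- A random coloring leaves all classes with colors in `T` independent only with small
probability, if the graph `A` has many vertices of large degree. -/
theorem pr_independent_classes_le_of_degree [Fintype ι] [DecidableEq ι] [DecidableEq α]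
    [Nonempty α] (A : Finset (ι × ι)) (Y : Finset ι)
    (N : ι → Finset ι) (hN : ∀ q ∈ Y, Disjoint (N q) Y) (hNc : ∀ q ∈ Y, Y.card ≤ (N q).card)
    (hA : ∀ q ∈ Y, ∀ u ∈ N q, (q, u) ∈ A) (T : Finset α) :
    pr (fun y : ι → α => ∀ b ∈ T, ∀ e ∈ A, ¬ (y e.1 = b ∧ y e.2 = b)) ≤
      2 ^ T.card * Real.exp (-(Y.card * T.card / Fintype.card α : ℝ)) := by
  rcases Y.eq_empty_or_nonempty with rfl | hY
  · refine (pr_le_avg (f := fun _ => 1) (fun _ => zero_le_one) fun _ _ => le_rfl).trans ?_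
    rw [avg_const]
    simpa using one_le_pow₀ (one_le_two (α := ℝ))
  calc _ ≤ avg fun y : ι → α =>
        ∏ q ∈ Y, if y q ∉ T ∩ (N q).image y then (1 : ℝ) else 0 := by
        refine pr_le_avg (fun y => Finset.prod_nonneg fun q _ => by split_ifs <;> norm_num)
          fun y hy => ?_
        rw [Finset.prod_congr rfl fun q hq => if_pos ?_]
        · simp
        · rw [Finset.mem_inter, Finset.mem_image]
          rintro ⟨hT, u, hu, huq⟩
          exact hy _ hT _ (hA q hq u hu) ⟨rfl, huq⟩
    _ = avg fun y : ι → α => ∏ q ∈ Y, (1 - ((T ∩ (N q).image y).card : ℝ) / Fintype.card α) := by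
        rw [← avg_piecewise Y]
        congr 1
        funext y
        have h : ∀ z : ι → α, (∏ q ∈ Y, if Y.piecewise z y q ∉ T ∩ (N q).image (Y.piecewise z y)
            then (1 : ℝ) else 0) = ∏ q ∈ Y, if z q ∉ T ∩ (N q).image y then (1 : ℝ) else 0 := by
          intro z
          refine Finset.prod_congr rfl fun q hq => ?_
          have h1 : (N q).image (Y.piecewise z y) = (N q).image y :=
            Finset.image_congr fun u hu =>
              Finset.piecewise_eq_of_notMem _ _ _ (Finset.disjoint_left.1 (hN q hq) hu)
          rw [h1, Finset.piecewise_eq_of_mem _ _ _ hq]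
        simp only [h]
        rw [avg_pi_finset Y fun q (b : α) => if b ∉ T ∩ (N q).image y then (1 : ℝ) else 0]
        exact Finset.prod_congr rfl fun q _ => avg_ite_notMem _
    _ ≤ avg fun y : ι → α => ∑ q ∈ Y, (Y.card : ℝ)⁻¹ *
        (1 - ((T ∩ (N q).image y).card : ℝ) / Fintype.card α) ^ Y.card :=
        avg_mono fun y => prod_le_avg_pow (fun q _ => one_sub_card_div_nonneg _) hY
    _ ≤ ∑ q ∈ Y, (Y.card : ℝ)⁻¹ *
        (2 ^ T.card * Real.exp (-(Y.card * T.card / Fintype.card α : ℝ))) := by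
        rw [avg_sum]
        refine Finset.sum_le_sum fun q hq => ?_
        rw [avg_const_mul]
        gcongr
        exact avg_one_sub_card_image_pow_le _ _ (hNc q hq)
    _ = _ := by
        have hc : (Y.card : ℝ) ≠ 0 := by exact_mod_cast hY.card_pos.ne'
        rw [Finset.sum_const, nsmul_eq_mul, mul_inv_cancel_left₀ hc]

theorem exists_large_degree_set [DecidableEq ι] {U : Finset ι} {A : Finset (ι × ι)} {k : ℕ} (hA : A ⊆ U ×ˢ U)
    (hk : 3 * k * U.card ≤ A.card) (hU : 0 < U.card) :
    ∃ Y : Finset ι, Y.card = k ∧ ∃ N : ι → Finset ι, (∀ q ∈ Y, Disjoint (N q) Y) ∧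
      (∀ q ∈ Y, Y.card ≤ (N q).card) ∧ ∀ q ∈ Y, ∀ u ∈ N q, (q, u) ∈ A := by
  set D : ι → Finset ι := fun q => U.filter fun u => (q, u) ∈ A with hD
  have hsum : A.card = ∑ q ∈ U, (D q).card := by
    rw [Finset.card_eq_sum_card_fiberwise (f := Prod.fst) (t := U)
      fun e he => (Finset.mem_product.1 (hA he)).1]
    refine Finset.sum_congr rfl fun q _ => ?_
    refine Finset.card_bij' (fun e _ => e.2) (fun u _ => (q, u)) ?_ ?_ ?_ ?_
    · rintro ⟨p, u⟩ h
      rw [Finset.mem_filter] at h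
      obtain ⟨h, rfl⟩ := h
      simpa [hD] using ⟨(Finset.mem_product.1 (hA h)).2, h⟩
    · intro u hu
      simpa [hD] using (Finset.mem_filter.1 hu).2
    · rintro ⟨p, u⟩ h
      rw [Finset.mem_filter] at h
      obtain ⟨h, rfl⟩ := h
      rfl
    · intro u _
      rfl
  set H := U.filter fun q => 2 * k ≤ (D q).card with hH
  have hHk : k ≤ H.card := by
    have h1 : ∀ q ∈ U, (D q).card ≤ (if 2 * k ≤ (D q).card then U.card else 0) + 2 * k := by
      intro q _
      split_ifs with h
      · exact (Finset.card_filter_le _ _).trans (Nat.le_add_right _ _)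
      · omega
    have h2 := Finset.sum_le_sum h1
    rw [← hsum, Finset.sum_add_distrib, ← Finset.sum_filter, Finset.sum_const, Finset.sum_const,
      smul_eq_mul, smul_eq_mul] at h2
    change A.card ≤ H.card * U.card + U.card * (2 * k) at h2
    refine Nat.le_of_mul_le_mul_right ?_ hU
    nlinarith
  obtain ⟨Y, hYH, hY⟩ := Finset.exists_subset_card_eq hHk
  refine ⟨Y, hY, fun q => D q \ Y, fun q _ => Finset.sdiff_disjoint, fun q hq => ?_,
    fun q _ u hu => (Finset.mem_filter.1 (Finset.mem_sdiff.1 hu).1).2⟩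
  have h1 := (Finset.mem_filter.1 (hYH hq)).2
  have h2 := Finset.le_card_sdiff Y (D q)
  change Y.card ≤ (D q \ Y).card
  omega

/-- With high probability, every dense graph `A` on `U` has an edge inside the neighbourhoods of
all but few vertices of the lift. -/
theorem pr_exists_independent_le {n ℓ : ℕ} [NeZero ℓ] {U : Finset (Fin n)} {k t : ℕ}
    (hU : 0 < U.card) (hk : 2 * Real.exp (-(k / ℓ : ℝ)) ≤ 1) :
    pr (fun σ : Fin n → Fin n → Equiv.Perm (Fin ℓ) => ∃ A ⊆ U ×ˢ U, 3 * k * U.card ≤ A.card ∧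
      ∃ T : Finset (Fin n × Fin ℓ), t ≤ T.card ∧
        ∀ w ∈ T, ∀ e ∈ A, ¬ (σ e.1 w.1 0 = w.2 ∧ σ e.2 w.1 0 = w.2)) ≤
      2 ^ (U.card ^ 2 + n * ℓ) * (2 * Real.exp (-(k / ℓ : ℝ))) ^ t := by
  set I := ((U ×ˢ U).powerset.filter fun A => 3 * k * U.card ≤ A.card) ×ˢ
    ((Finset.univ : Finset (Finset (Fin n × Fin ℓ))).filter fun T => t ≤ T.card) with hI
  have hcard : (I.card : ℝ) ≤ 2 ^ (U.card ^ 2 + n * ℓ) := by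
    have h1 := Finset.card_filter_le (U ×ˢ U).powerset fun A => 3 * k * U.card ≤ A.card
    have h2 := Finset.card_filter_le (Finset.univ : Finset (Finset (Fin n × Fin ℓ)))
      fun T => t ≤ T.card
    rw [Finset.card_powerset, Finset.card_product, ← sq] at h1
    rw [Finset.card_univ, Fintype.card_finset, Fintype.card_prod, Fintype.card_fin,
      Fintype.card_fin] at h2
    have h3 : I.card ≤ 2 ^ (U.card ^ 2 + n * ℓ) := by
      rw [hI, Finset.card_product, pow_add]
      gcongr
    exact_mod_cast h3
  calc _ ≤ pr fun σ : Fin n → Fin n → Equiv.Perm (Fin ℓ) =>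
        ∃ i ∈ I, ∀ w ∈ i.2, ∀ e ∈ i.1, ¬ (σ e.1 w.1 0 = w.2 ∧ σ e.2 w.1 0 = w.2) := by
        refine pr_mono ?_
        rintro σ ⟨A, hA, hAk, T, hT, h⟩
        exact ⟨(A, T), by simp [hI, hA, hAk, hT], h⟩
    _ ≤ I.card * (2 * Real.exp (-(k / ℓ : ℝ))) ^ t := by
        refine pr_exists_le_card_mul _ _ fun i hi => ?_
        simp only [hI, Finset.mem_product, Finset.mem_filter, Finset.mem_powerset,
          Finset.mem_univ, true_and] at hi
        obtain ⟨⟨hA, hAk⟩, hT⟩ := hi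
        obtain ⟨Y, hYk, N, hN, hNc, hNA⟩ := exists_large_degree_set hA hAk hU
        refine le_trans ?_ (pow_le_pow_of_le_one (by positivity) hk hT)
        rw [pr_apply_zero fun y : Fin n → Fin n → Fin ℓ =>
          ∀ w ∈ i.2, ∀ e ∈ i.1, ¬ (y e.1 w.1 = w.2 ∧ y e.2 w.1 = w.2)]
        set S : Fin n → Finset (Fin ℓ) := fun j => Finset.univ.filter fun b => (j, b) ∈ i.2 with hS
        have hST : i.2.card = ∑ j, (S j).card := by
          rw [Finset.card_eq_sum_card_fiberwise (f := Prod.fst) (t := Finset.univ) (by simp)]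
          refine Finset.sum_congr rfl fun j _ => ?_
          refine Finset.card_bij' (fun p _ => p.2) (fun a _ => (j, a)) ?_ ?_ ?_ ?_
          · rintro ⟨j', a⟩ h
            obtain ⟨h, rfl⟩ := Finset.mem_filter.1 h
            simpa [hS] using h
          · intro a ha; simpa [hS] using ha
          · rintro ⟨j', a⟩ h
            obtain ⟨h, rfl⟩ := Finset.mem_filter.1 h
            rfl
          · intro a _; rfl
        classical
        calc _ ≤ avg fun y : Fin n → Fin n → Fin ℓ => ∏ j,
              if ∀ b ∈ S j, ∀ e ∈ i.1, ¬ (y e.1 j = b ∧ y e.2 j = b) then (1 : ℝ) else 0 := by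
              refine pr_le_avg (fun y => Finset.prod_nonneg fun q _ => by split_ifs <;> norm_num)
                fun y hy => ?_
              rw [Finset.prod_congr rfl fun j _ => if_pos ?_]
              · simp
              · intro b hb e he
                exact hy (j, b) (Finset.mem_filter.1 hb).2 e he
          _ = avg fun y : Fin n → Fin n → Fin ℓ => ∏ j,
              if ∀ b ∈ S j, ∀ e ∈ i.1, ¬ (y j e.1 = b ∧ y j e.2 = b) then (1 : ℝ) else 0 :=
              avg_comp_equiv (Equiv.piComm fun _ _ => Fin ℓ) fun y : Fin n → Fin n → Fin ℓ =>
                ∏ j, if ∀ b ∈ S j, ∀ e ∈ i.1, ¬ (y j e.1 = b ∧ y j e.2 = b) then (1 : ℝ) else 0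
          _ = ∏ j, pr fun y : Fin n → Fin ℓ =>
              ∀ b ∈ S j, ∀ e ∈ i.1, ¬ (y e.1 = b ∧ y e.2 = b) := by
              rw [avg_pi fun j (y : Fin n → Fin ℓ) =>
                if ∀ b ∈ S j, ∀ e ∈ i.1, ¬ (y e.1 = b ∧ y e.2 = b) then (1 : ℝ) else 0]
              refine Finset.prod_congr rfl fun j _ => ?_
              unfold pr
              congr 1
              funext y
              congr
          _ ≤ ∏ j, (2 * Real.exp (-(k / ℓ : ℝ))) ^ (S j).card := by
              refine Finset.prod_le_prod (fun j _ => pr_nonneg _) fun j _ => ?_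
              refine (pr_independent_classes_le_of_degree i.1 Y N hN hNc hNA (S j)).trans_eq ?_
              rw [mul_pow, ← Real.exp_nat_mul, hYk, Fintype.card_fin]
              congr 2
              ring
          _ = _ := by rw [Finset.prod_pow_eq_pow_sum, hST]
    _ ≤ _ := by gcongr

end Coloring

section TopologicalCliques

variable {V : Type*} {G : SimpleGraph V} {n ℓ : ℕ}

theorem HasTopClique.mono {m m' : ℕ} (h : HasTopClique G m) (hm : m' ≤ m) : HasTopClique G m' := by
  obtain ⟨f, hf, P, hP, hb, hd⟩ := h
  refine ⟨f ∘ Fin.castLE hm, hf.comp (Fin.castLE_injective hm),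
    fun i j => P (Fin.castLE hm i) (Fin.castLE hm j), fun i j hij => hP _ _ hij,
    fun i j hij k => hb _ _ hij _, fun i j i' j' hij hij' hne => hd _ _ _ _ hij hij' fun h => hne ?_⟩
  rw [Prod.mk.injEq] at h ⊢
  exact ⟨Fin.castLE_injective hm h.1, Fin.castLE_injective hm h.2⟩

theorem bddAbove_hasTopClique [Fintype V] (G : SimpleGraph V) :
    BddAbove {m | HasTopClique G m} := by
  refine ⟨Fintype.card V, ?_⟩
  rintro m ⟨f, hf, -⟩
  simpa using Fintype.card_le_of_injective f hf

theorem HasTopClique.le_hajosNumber [Fintype V] {m : ℕ} (h : HasTopClique G m) :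
    m ≤ hajosNumber G :=
  le_csSup (bddAbove_hasTopClique G) h

theorem hasTopClique_hajosNumber [Fintype V] (G : SimpleGraph V) :
    HasTopClique G (hajosNumber G) := by
  have h : HasTopClique G 0 := ⟨Fin.elim0, fun i => i.elim0, fun i => i.elim0, fun i => i.elim0,
    fun i => i.elim0, fun i => i.elim0⟩
  exact Nat.sSup_mem ⟨0, h⟩ (bddAbove_hasTopClique G)

theorem SimpleGraph.Walk.interior_ne_nil_of_not_adj {u v : V} (w : G.Walk u v) (hne : u ≠ v)
    (hadj : ¬ G.Adj u v) : w.support.tail.dropLast ≠ [] := by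
  cases w with
  | nil => exact absurd rfl hne
  | cons h p =>
    cases p with
    | nil => exact absurd h hadj
    | cons h' p' => simp [SimpleGraph.Walk.support_cons, List.dropLast_cons_of_ne_nil]

theorem HasTopCliqueFun.card_not_adj_le [Fintype V] {m : ℕ} {f : Fin m → V}
    (h : HasTopCliqueFun G f) [DecidableRel G.Adj] :
    ((Finset.univ : Finset (Fin m × Fin m)).filter
      fun q => q.1 < q.2 ∧ ¬ G.Adj (f q.1) (f q.2)).card ≤ Fintype.card V := by
  obtain ⟨hf, P, -, -, hd⟩ := h
  have hex : ∀ q : Fin m × Fin m, q.1 < q.2 ∧ ¬ G.Adj (f q.1) (f q.2) →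
      ∃ x, x ∈ (P q.1 q.2).support.tail.dropLast := fun q hq =>
    List.exists_mem_of_ne_nil _
      ((P q.1 q.2).interior_ne_nil_of_not_adj (fun e => hq.1.ne (hf e)) hq.2)
  rcases isEmpty_or_nonempty V with hV | hV
  · have : IsEmpty (Fin m) := f.isEmpty
    simp
  choose! g hg using hex
  refine Finset.card_le_card_of_injOn g (fun _ _ => Finset.mem_univ _) ?_
  intro q hq q' hq' hgq
  simp only [Finset.coe_filter, Finset.mem_univ, true_and, Set.mem_ofPred_eq] at hq hq'
  by_contra hne
  exact hd q.1 q.2 q'.1 q'.2 hq.1 hq'.1 hne (g q) (hg q hq) (hgq ▸ hg q' hq')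

theorem liftGraph_adj (σ : Fin n → Fin n → Equiv.Perm (Fin ℓ)) (x y : Fin n × Fin ℓ) :
    (liftGraph n ℓ σ).Adj x y ↔ (x.1 < y.1 ∧ σ x.1 y.1 x.2 = y.2) ∨
      (y.1 < x.1 ∧ σ y.1 x.1 y.2 = x.2) := by
  rw [liftGraph, SimpleGraph.fromRel_adj, and_iff_right_iff_imp]
  rintro (h | h) rfl <;> exact lt_irrefl _ h.1

theorem HasTopClique.exists_liftEdges {σ : Fin n → Fin n → Equiv.Perm (Fin ℓ)} {m : ℕ}
    (h : HasTopClique (liftGraph n ℓ σ) m) :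
    ∃ S : Finset (Fin n × Fin ℓ), S.card = m ∧ m.choose 2 ≤ n * ℓ + (liftEdges σ S).card := by
  classical
  obtain ⟨f, hf⟩ := h
  have hinj := hf.1
  refine ⟨Finset.univ.image f, by rw [Finset.card_image_of_injective _ hinj, Finset.card_fin], ?_⟩
  have h1 := hf.card_not_adj_le
  rw [Fintype.card_prod, Fintype.card_fin, Fintype.card_fin] at h1
  have h2 : ((Finset.univ : Finset (Fin m × Fin m)).filter
      fun q => q.1 < q.2 ∧ (liftGraph n ℓ σ).Adj (f q.1) (f q.2)).card ≤
      (liftEdges σ (Finset.univ.image f)).card := by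
    refine Finset.card_le_card_of_injOn
      (fun q => if (f q.1).1 < (f q.2).1 then (f q.1, f q.2) else (f q.2, f q.1)) ?_ ?_
    · intro q hq
      simp only [Finset.coe_filter, Finset.mem_univ, true_and, Set.mem_ofPred_eq,
        liftGraph_adj] at hq
      rcases hq.2 with h | h
      · simp [liftEdges, h.1, h.2]
      · simp [liftEdges, h.1.not_gt, h.1, h.2]
    · intro q hq q' hq' he
      simp only [Finset.coe_filter, Finset.mem_univ, true_and, Set.mem_ofPred_eq] at hq hq'
      have hlt := hq.1
      have hlt' := hq'.1
      simp only at he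
      split_ifs at he <;> simp only [Prod.mk.injEq, hinj.eq_iff] at he
      · exact Prod.ext he.1 he.2
      · rw [he.1, he.2] at hlt
        exact absurd hlt hlt'.asymm
      · rw [he.1, he.2] at hlt
        exact absurd hlt hlt'.asymm
      · exact Prod.ext he.2 he.1
  have h3 : ((Finset.univ : Finset (Fin m × Fin m)).filter fun q => q.1 < q.2).card =
      m.choose 2 := by
    have h4 := Finset.card_powersetCard 2 (Finset.univ : Finset (Fin m))
    rw [Finset.card_fin] at h4
    rw [← h4]
    refine Finset.card_bij (fun q _ => {q.1, q.2}) ?_ ?_ ?_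
    · intro q hq
      rw [Finset.mem_filter] at hq
      simp [Finset.mem_powersetCard, Finset.card_pair hq.2.ne]
    · rintro ⟨a, b⟩ hq ⟨c, d⟩ hq' he
      simp only [Finset.mem_filter, Finset.mem_univ, true_and] at hq hq'
      have ha : a ∈ ({c, d} : Finset (Fin m)) := by rw [← he]; simp
      have hb : b ∈ ({c, d} : Finset (Fin m)) := by rw [← he]; simp
      simp only [Finset.mem_insert, Finset.mem_singleton] at ha hb
      grind
    · intro s hs
      obtain ⟨a, b, hab, rfl⟩ := Finset.card_eq_two.1 (Finset.mem_powersetCard.1 hs).2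
      rcases hab.lt_or_gt with h | h
      · exact ⟨(a, b), by simpa using h, rfl⟩
      · exact ⟨(b, a), by simpa using h, Finset.pair_comm _ _⟩
  have h5 := Finset.card_filter_add_card_filter_not
    (s := (Finset.univ : Finset (Fin m × Fin m)).filter fun q => q.1 < q.2)
    (fun q => (liftGraph n ℓ σ).Adj (f q.1) (f q.2))
  rw [Finset.filter_filter, Finset.filter_filter, h3] at h5
  omega

/-- A topological clique from connecting walks whose interiors lie in disjoint sets. -/
theorem hasTopClique_of_walks {ι : Type*} [LinearOrder ι] (B : Finset ι) (f : ι → V)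
    (hf : Function.Injective f) (S : ι → ι → Set V)
    (hw : ∀ i ∈ B, ∀ j ∈ B, i < j →
      ∃ w : G.Walk (f i) (f j), w.IsPath ∧ ∀ x ∈ w.support.tail.dropLast, x ∈ S i j)
    (hS : ∀ i ∈ B, ∀ j ∈ B, i < j → ∀ k ∈ B, f k ∉ S i j)
    (hd : ∀ i ∈ B, ∀ j ∈ B, ∀ i' ∈ B, ∀ j' ∈ B, i < j → i' < j' → (i, j) ≠ (i', j') →
      Disjoint (S i j) (S i' j')) : HasTopClique G B.card := by
  set g := B.orderEmbOfFin rfl with hg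
  have hgB : ∀ i, g i ∈ B := fun i => Finset.orderEmbOfFin_mem B rfl i
  have hex : ∀ i j, ∃ w : G.Walk (f (g i)) (f (g j)), i < j →
      w.IsPath ∧ ∀ x ∈ w.support.tail.dropLast, x ∈ S (g i) (g j) := by
    intro i j
    rcases lt_trichotomy i j with h | rfl | h
    · obtain ⟨w, h'⟩ := hw _ (hgB i) _ (hgB j) (g.lt_iff_lt.2 h)
      exact ⟨w, fun _ => h'⟩
    · exact ⟨SimpleGraph.Walk.nil, fun h => absurd h (lt_irrefl _)⟩
    · obtain ⟨w, -⟩ := hw _ (hgB j) _ (hgB i) (g.lt_iff_lt.2 h)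
      exact ⟨w.reverse, fun h' => absurd h' h.asymm⟩
  choose P hP using hex
  refine ⟨f ∘ g, hf.comp g.injective, P, fun i j hij => (hP i j hij).1, fun i j hij k hk =>
    hS _ (hgB i) _ (hgB j) (g.lt_iff_lt.2 hij) _ (hgB k) ((hP i j hij).2 _ hk),
    fun i j i' j' hij hij' hne x hx hx' => ?_⟩
  refine Set.disjoint_left.1 (hd _ (hgB i) _ (hgB j) _ (hgB i') _ (hgB j') (g.lt_iff_lt.2 hij)
    (g.lt_iff_lt.2 hij') fun h => hne ?_) ((hP i j hij).2 x hx) ((hP i' j' hij').2 x hx')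
  rw [Prod.mk.injEq] at h ⊢
  exact ⟨g.injective h.1, g.injective h.2⟩

end TopologicalCliques

section Matching

/-- Hall's theorem with deficiency `d`. -/
theorem exists_injOn_of_card_le_card_biUnion_add {ι α : Type*} [DecidableEq ι] [DecidableEq α]
    [Nonempty α] (P : Finset ι) (N : ι → Finset α) (d : ℕ)
    (h : ∀ A ⊆ P, A.card ≤ (A.biUnion N).card + d) :
    ∃ L ⊆ P, L.card ≤ d ∧ ∃ w : ι → α, Set.InjOn w ↑(P \ L) ∧ ∀ e ∈ P \ L, w e ∈ N e := by
  have hall : ∀ A : Finset P, A.card ≤ (A.biUnion fun e => (N e).disjSum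
      (Finset.univ : Finset (Fin d))).card := by
    intro A
    rcases A.eq_empty_or_nonempty with rfl | hA
    · simp
    · have h1 := h (A.map (Function.Embedding.subtype _)) fun e he => by
        obtain ⟨⟨e, he'⟩, -, rfl⟩ := Finset.mem_map.1 he
        exact he'
      rw [Finset.card_map] at h1
      refine h1.trans ?_
      have h2 : (A.biUnion fun e => (N e).disjSum (Finset.univ : Finset (Fin d))) =
          ((A.map (Function.Embedding.subtype _)).biUnion N).disjSum Finset.univ := by
        ext x
        rcases x with x | x
        · simp
        · obtain ⟨e, he⟩ := hA
          simp only [Finset.mem_biUnion, Finset.inr_mem_disjSum, Finset.mem_univ, and_true, iff_true]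
          exact ⟨e, he⟩
      rw [h2, Finset.card_disjSum, Finset.card_fin]
  obtain ⟨φ, hφ, hφN⟩ := (Finset.all_card_le_biUnion_card_iff_exists_injective _).1 hall
  set L : Finset P := Finset.univ.filter fun e => (φ e).isRight with hL
  set w : ι → α := fun e => if he : e ∈ P then
    ((φ ⟨e, he⟩).getLeft?).getD (Classical.arbitrary α) else Classical.arbitrary α with hw
  have hwφ : ∀ e (he : e ∈ P \ L.map (Function.Embedding.subtype _)),
      φ ⟨e, (Finset.mem_sdiff.1 he).1⟩ = Sum.inl (w e) := by
    intro e he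
    obtain ⟨heP, heL⟩ := Finset.mem_sdiff.1 he
    simp only [hw, dif_pos heP]
    rcases hx : φ ⟨e, heP⟩ with x | x
    · simp
    · have h3 : (⟨e, heP⟩ : P) ∈ L := by simp [hL, hx]
      exact absurd (Finset.mem_map_of_mem (Function.Embedding.subtype _) h3) heL
  refine ⟨L.map (Function.Embedding.subtype _), fun e he => ?_, ?_, w, ?_, ?_⟩
  · obtain ⟨⟨e, he'⟩, -, rfl⟩ := Finset.mem_map.1 he
    exact he'
  · rw [Finset.card_map]
    have h3 : (L.image φ).card ≤ ((Finset.univ : Finset (Fin d)).map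
        (Function.Embedding.inr (α := α))).card := by
      refine Finset.card_le_card fun x hx => ?_
      obtain ⟨e, he, rfl⟩ := Finset.mem_image.1 hx
      obtain ⟨y, hy⟩ := Sum.isRight_iff.1 (Finset.mem_filter.1 he).2
      simp [hy]
    rwa [Finset.card_image_of_injective _ hφ, Finset.card_map, Finset.card_fin] at h3
  · intro e he e' he' hee
    have h4 := (hwφ e he).trans ((congrArg Sum.inl hee).trans (hwφ e' he').symm)
    exact congrArg Subtype.val (hφ h4)
  · intro e he
    have h5 := hφN ⟨e, (Finset.mem_sdiff.1 he).1⟩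
    rw [hwφ e he] at h5
    simpa using h5

end Matching

section Completion

variable {n ℓ : ℕ} [NeZero ℓ]

/-- The fibers of `R` in which the neighbour of `(u, 0)` lies in `X`. -/
def usedFibers (σ : Fin n → Fin n → Equiv.Perm (Fin ℓ)) (R : Finset (Fin n))
    (X : Finset (Fin n × Fin ℓ)) (u : Fin n) : Finset (Fin n) :=
  R.filter fun j => (j, σ u j 0) ∈ X

theorem sum_card_fiber_sq {ι α : Type*} [DecidableEq ι] [Fintype α] [DecidableEq α]
    (U : Finset ι) (f : ι → α) :
    ∑ b, (U.filter fun u => f u = b).card ^ 2 = ((U ×ˢ U).filter fun q => f q.1 = f q.2).card := by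
  rw [Finset.card_eq_sum_card_fiberwise (f := fun q => f q.1) (t := Finset.univ) (by simp)]
  refine Finset.sum_congr rfl fun b _ => ?_
  rw [sq, ← Finset.card_product]
  congr 1
  ext ⟨u, v⟩
  simp only [Finset.mem_product, Finset.mem_filter]
  grind

/-- Only few vertices of `U` have many neighbours in a small set `X`. -/
theorem card_heavy_mul_le (σ : Fin n → Fin n → Equiv.Perm (Fin ℓ)) (U R : Finset (Fin n))
    (X : Finset (Fin n × Fin ℓ)) (r : ℕ) {lam : ℝ} (hlam : 0 < lam) :
    ((U.filter fun u => r < 2 * (usedFibers σ R X u).card).card : ℝ) * r ≤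
      2 * (lam * X.card + codegreeSum U R σ / lam) := by
  set D' : Fin n × Fin ℓ → Finset (Fin n) := fun w => U.filter fun u => σ u w.1 0 = w.2 with hD
  set D : Fin n × Fin ℓ → ℕ := fun w => (D' w).card with hD'
  have h1 : (U.filter fun u => r < 2 * (usedFibers σ R X u).card).card * r ≤
      2 * ∑ u ∈ U, (usedFibers σ R X u).card := by
    rw [Finset.mul_sum]
    calc _ ≤ ∑ u ∈ U.filter fun u => r < 2 * (usedFibers σ R X u).card,
          2 * (usedFibers σ R X u).card := by
          rw [← smul_eq_mul]
          exact Finset.card_nsmul_le_sum _ _ _ fun u hu => (Finset.mem_filter.1 hu).2.le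
      _ ≤ _ := Finset.sum_le_sum_of_subset (Finset.filter_subset _ _)
  have h2 : ∑ u ∈ U, (usedFibers σ R X u).card = ∑ w ∈ X.filter fun w => w.1 ∈ R, D w := by
    rw [← Finset.card_sigma, ← Finset.card_sigma]
    refine Finset.card_bij (fun q _ => ⟨(q.2, σ q.1 q.2 0), q.1⟩) ?_ ?_ ?_
    · rintro ⟨u, j⟩ h
      simp_all [usedFibers]
    · rintro ⟨u, j⟩ h ⟨u', j'⟩ h' he
      simp_all
    · rintro ⟨⟨j, b⟩, u⟩ h
      simp only [hD, Finset.mem_sigma, Finset.mem_filter] at h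
      obtain ⟨⟨h1, h2⟩, h3, rfl⟩ := h
      exact ⟨⟨u, j⟩, by simp [usedFibers, h1, h2, h3], rfl⟩
  have h4 : ∑ w ∈ X.filter fun w => w.1 ∈ R, (D w : ℝ) ^ 2 ≤ codegreeSum U R σ := by
    have h5 : ∑ w ∈ R ×ˢ (Finset.univ : Finset (Fin ℓ)), D w ^ 2 = codegreeSum U R σ := by
      rw [Finset.sum_product, codegreeSum]
      exact Finset.sum_congr rfl fun j _ => sum_card_fiber_sq U fun u => σ u j 0
    rw [← h5]
    push_cast
    refine Finset.sum_le_sum_of_subset_of_nonneg (fun w hw => ?_) fun _ _ _ => by positivity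
    simpa using (Finset.mem_filter.1 hw).2
  have h6 : ∀ w, (D w : ℝ) ≤ lam + (D w : ℝ) ^ 2 / lam := by
    intro w
    rw [← sub_nonneg]
    have : lam + (D w : ℝ) ^ 2 / lam - D w = ((lam - D w) ^ 2 + lam * D w) / lam := by
      field_simp
      ring
    rw [this]
    positivity
  calc _ ≤ (2 : ℝ) * ∑ w ∈ X.filter fun w => w.1 ∈ R, (D w : ℝ) := by
        rw [h2] at h1
        exact_mod_cast h1
    _ ≤ 2 * ∑ w ∈ X.filter fun w => w.1 ∈ R, (lam + (D w : ℝ) ^ 2 / lam) := by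
        gcongr with w
        exact h6 w
    _ ≤ _ := by
        rw [Finset.sum_add_distrib, ← Finset.sum_div, Finset.sum_const, nsmul_eq_mul, mul_comm lam]
        gcongr
        exact Finset.filter_subset _ _

end Completion

section Routing

/-- A maximal system of pairs `x e`, `y e` related by `Q e`, without repetition among the `x e`
and among the `y e`. -/
theorem exists_maximal_injOn_pair {ι α : Type*} [DecidableEq ι] [DecidableEq α] [Nonempty α]
    (L : Finset ι) (Q : ι → α → α → Prop) :
    ∃ L' ⊆ L, ∃ x y : ι → α, Set.InjOn x ↑L' ∧ Set.InjOn y ↑L' ∧ (∀ e ∈ L', Q e (x e) (y e)) ∧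
      ∀ e ∈ L, e ∉ L' → ∀ a b, Q e a b → a ∈ L'.image x ∨ b ∈ L'.image y := by
  induction L using Finset.induction_on with
  | empty => exact ⟨∅, subset_rfl, fun _ => Classical.arbitrary α, fun _ => Classical.arbitrary α,
      by simp, by simp, by simp, by simp⟩
  | insert e L he ih =>
    obtain ⟨L', hL', x, y, hx, hy, hQ, hmax⟩ := ih
    by_cases hab : ∃ a b, Q e a b ∧ a ∉ L'.image x ∧ b ∉ L'.image y
    · obtain ⟨a, b, hab, ha, hb⟩ := hab
      have heL' : e ∉ L' := fun h => he (hL' h)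
      have hne : ∀ e' ∈ L', e' ≠ e := fun e' h h' => heL' (h' ▸ h)
      have himage : ∀ (z : ι → α) c, (insert e L').image (Function.update z e c) =
          insert c (L'.image z) := by
        intro z c
        rw [Finset.image_insert, Function.update_self]
        congr 1
        exact Finset.image_congr fun e' h => Function.update_of_ne (hne e' h) _ _
      have hinj : ∀ (z : ι → α) c, Set.InjOn z ↑L' → c ∉ L'.image z →
          Set.InjOn (Function.update z e c) ↑(insert e L') := by
        intro z c hz hc
        rw [Finset.coe_insert, Set.injOn_insert (by simpa using heL')]
        constructor
        · exact hz.congr fun e' h => (Function.update_of_ne (hne e' h) _ _).symm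
        · rintro ⟨e', h, h'⟩
          rw [Function.update_self, Function.update_of_ne (hne e' h)] at h'
          exact hc (Finset.mem_image.2 ⟨e', h, h'⟩)
      refine ⟨insert e L', Finset.insert_subset_insert e hL', Function.update x e a,
        Function.update y e b, hinj x a hx ha, hinj y b hy hb, ?_, ?_⟩
      · intro e' h
        rcases Finset.mem_insert.1 h with rfl | h
        · simpa using hab
        · simpa [Function.update_of_ne (hne e' h)] using hQ e' h
      · intro e' h h' a' b' hQ'
        rw [Finset.mem_insert, not_or] at h'
        rw [himage, himage, Finset.mem_insert, Finset.mem_insert]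
        have := hmax e' ((Finset.mem_insert.1 h).resolve_left h'.1) h'.2 a' b' hQ'
        tauto
    · refine ⟨L', hL'.trans (Finset.subset_insert e L), x, y, hx, hy, hQ, fun e' h h' a b hQ' => ?_⟩
      rcases Finset.mem_insert.1 h with rfl | h
      · by_contra! hc
        exact hab ⟨a, b, hQ', hc⟩
      · exact hmax e' h h' a b hQ'

variable {n ℓ : ℕ}

theorem liftGraph_adj_of_lt {σ : Fin n → Fin n → Equiv.Perm (Fin ℓ)} {x y : Fin n × Fin ℓ}
    (h : x.1 < y.1) (h' : σ x.1 y.1 x.2 = y.2) : (liftGraph n ℓ σ).Adj x y :=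
  (liftGraph_adj σ x y).2 (Or.inl ⟨h, h'⟩)

variable [NeZero ℓ]

/-- The vertices of `U` with many neighbours of `(u, 0)` in `X` above `R`. -/
def heavy (σ : Fin n → Fin n → Equiv.Perm (Fin ℓ)) (U R : Finset (Fin n))
    (X : Finset (Fin n × Fin ℓ)) (r : ℕ) : Finset (Fin n) :=
  U.filter fun u => r < 2 * (usedFibers σ R X u).card

theorem le_two_mul_card_sdiff_usedFibers {σ : Fin n → Fin n → Equiv.Perm (Fin ℓ)}
    {U R : Finset (Fin n)} {X : Finset (Fin n × Fin ℓ)} {r : ℕ} (hR : R.card = r) {u : Fin n}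
    (hu : u ∈ U) (hu' : u ∉ heavy σ U R X r) : r ≤ 2 * (R \ usedFibers σ R X u).card := by
  have h1 : 2 * (usedFibers σ R X u).card ≤ r := by
    by_contra! h
    exact hu' (Finset.mem_filter.2 ⟨hu, h⟩)
  have h2 := Finset.le_card_sdiff (usedFibers σ R X u) R
  omega

/-- The vertices `(u, 0)`, `u ∈ U`, outside two small exceptional sets, are the branch vertices
of a topological clique: nonadjacent pairs are joined by paths of length two through the fibers of
`J`, except for few pairs that are joined by paths of length three through those of `R₁`, `R₂`. -/
theorem exists_hasTopClique (σ : Fin n → Fin n → Equiv.Perm (Fin ℓ)) (U R₁ R₂ J : Finset (Fin n))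
    {r d t : ℕ} (hU₁ : ∀ u ∈ U, ∀ j ∈ R₁, u < j) (hU₂ : ∀ u ∈ U, ∀ j ∈ R₂, u < j)
    (hUJ : ∀ u ∈ U, ∀ j ∈ J, u < j) (hR : ∀ j ∈ R₁, ∀ k ∈ R₂, j < k) (hJ₁ : ∀ j ∈ R₁, j ∉ J)
    (hJ₂ : ∀ j ∈ R₂, j ∉ J) (hR₁ : R₁.card = r) (hR₂ : R₂.card = r)
    (hHall : ∀ A ⊆ U ×ˢ U, d ≤ A.card → ∀ T : Finset (Fin n × Fin ℓ),
      (∀ w ∈ T, ∀ e ∈ A, ¬(σ e.1 w.1 0 = w.2 ∧ σ e.2 w.1 0 = w.2)) → T.card < t)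
    (hcard : ((U ×ˢ U).filter fun q => q.1 < q.2 ∧ σ q.1 q.2 0 ≠ 0).card + t ≤ J.card * ℓ)
    (hconn : ∀ u ∈ U, ∀ v ∈ U, ∀ J₁ ⊆ R₁, ∀ J₂ ⊆ R₂, r ≤ 2 * J₁.card → r ≤ 2 * J₂.card →
      ∃ j ∈ J₁, ∃ k ∈ J₂, σ j k (σ u j 0) = σ v k 0) :
    ∃ X₁ X₂ : Finset (Fin n × Fin ℓ), X₁.card ≤ d ∧ X₂.card ≤ d ∧
      HasTopClique (liftGraph n ℓ σ) (U \ (heavy σ U R₁ X₁ r ∪ heavy σ U R₂ X₂ r)).card := by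
  rcases U.eq_empty_or_nonempty with rfl | ⟨u₀, hu₀⟩
  · refine ⟨∅, ∅, by simp, by simp, ?_⟩
    simpa using hasTopClique_of_walks (G := liftGraph n ℓ σ) (∅ : Finset (Fin n))
      (fun p => (p, 0)) (fun p q h => (Prod.ext_iff.1 h).1) (fun _ _ => ∅) (by simp) (by simp)
      (by simp)
  have : Nonempty (Fin n × Fin ℓ) := ⟨(u₀, 0)⟩
  set P := (U ×ˢ U).filter fun q => q.1 < q.2 ∧ σ q.1 q.2 0 ≠ 0 with hP
  set N : Fin n × Fin n → Finset (Fin n × Fin ℓ) := fun e =>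
    (J ×ˢ Finset.univ).filter fun w => σ e.1 w.1 0 = w.2 ∧ σ e.2 w.1 0 = w.2 with hN
  have hdef : ∀ A ⊆ P, A.card ≤ (A.biUnion N).card + d := by
    intro A hA
    rcases le_total A.card d with h | h
    · omega
    · have h1 := hHall A (hA.trans (Finset.filter_subset _ _)) h
        ((J ×ˢ Finset.univ) \ A.biUnion N) fun w hw e he hwe => by
          rw [Finset.mem_sdiff] at hw
          exact hw.2 (Finset.mem_biUnion.2 ⟨e, he, Finset.mem_filter.2 ⟨hw.1, hwe⟩⟩)
      have h2 := Finset.le_card_sdiff (A.biUnion N) (J ×ˢ (Finset.univ : Finset (Fin ℓ)))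
      have h3 := Finset.card_le_card hA
      rw [Finset.card_product, Finset.card_fin] at h2
      omega
  obtain ⟨L, hLP, hLd, w, hw, hwN⟩ := exists_injOn_of_card_le_card_biUnion_add P N d hdef
  obtain ⟨L', hL', x, y, hx, hy, hxy, hmax⟩ := exists_maximal_injOn_pair L
    fun e (a b : Fin n × Fin ℓ) => a.1 ∈ R₁ ∧ b.1 ∈ R₂ ∧ σ e.1 a.1 0 = a.2 ∧ σ e.2 b.1 0 = b.2 ∧
      σ a.1 b.1 a.2 = b.2
  refine ⟨L'.image x, L'.image y, Finset.card_image_le.trans ((Finset.card_le_card hL').trans hLd),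
    Finset.card_image_le.trans ((Finset.card_le_card hL').trans hLd), ?_⟩
  set B := U \ (heavy σ U R₁ (L'.image x) r ∪ heavy σ U R₂ (L'.image y) r) with hB
  have hBU : ∀ p ∈ B, p ∈ U := fun p hp => (Finset.mem_sdiff.1 hp).1
  have hLL' : ∀ p ∈ B, ∀ q ∈ B, (p, q) ∈ L → (p, q) ∈ L' := by
    intro p hp q hq hpq
    by_contra hpq'
    have hp' := (Finset.mem_sdiff.1 hp).2
    have hq' := (Finset.mem_sdiff.1 hq).2
    rw [Finset.mem_union, not_or] at hp' hq'
    obtain ⟨j, hj, k, hk, hjk⟩ := hconn p (hBU p hp) q (hBU q hq) _ Finset.sdiff_subset _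
      Finset.sdiff_subset (le_two_mul_card_sdiff_usedFibers hR₁ (hBU p hp) hp'.1)
      (le_two_mul_card_sdiff_usedFibers hR₂ (hBU q hq) hq'.2)
    simp only [usedFibers, Finset.mem_sdiff, Finset.mem_filter, not_and] at hj hk
    rcases hmax _ hpq hpq' (j, σ p j 0) (k, σ q k 0) ⟨hj.1, hk.1, rfl, rfl, hjk⟩ with h | h
    · exact hj.2 hj.1 h
    · exact hk.2 hk.1 h
  have hwN' : ∀ e ∈ P \ L, (w e).1 ∈ J ∧ σ e.1 (w e).1 0 = (w e).2 ∧ σ e.2 (w e).1 0 = (w e).2 := by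
    intro e he
    simpa [hN] using hwN e he
  have hcase : ∀ p ∈ B, ∀ q ∈ B, p < q →
      σ p q 0 = 0 ∨ (p, q) ∈ P \ L ∨ (p, q) ∈ L' := by
    intro p hp q hq hpq
    by_cases h0 : σ p q 0 = 0
    · exact Or.inl h0
    · by_cases hL : (p, q) ∈ L
      · exact Or.inr (Or.inr (hLL' p hp q hq hL))
      · exact Or.inr (Or.inl (Finset.mem_sdiff.2 ⟨by simp [hP, hBU p hp, hBU q hq, hpq, h0], hL⟩))
  set S : Fin n → Fin n → Set (Fin n × Fin ℓ) := fun p q =>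
    {z | ((p, q) ∈ P \ L ∧ z = w (p, q)) ∨ ((p, q) ∈ L' ∧ (z = x (p, q) ∨ z = y (p, q)))} with hS
  refine hasTopClique_of_walks B (fun p => (p, 0)) (fun p q h => (Prod.ext_iff.1 h).1) S ?_ ?_ ?_
  · intro p hp q hq hpq
    rcases hcase p hp q hq hpq with h0 | h0 | h0
    · have ha : (liftGraph n ℓ σ).Adj (p, 0) (q, 0) := liftGraph_adj_of_lt hpq h0
      exact ⟨ha.toWalk, by simp [ha.ne], by simp⟩
    · obtain ⟨h1, h2, h3⟩ := hwN' _ h0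
      have ha : (liftGraph n ℓ σ).Adj (p, 0) (w (p, q)) :=
        liftGraph_adj_of_lt (hUJ p (hBU p hp) _ h1) h2
      have hb : (liftGraph n ℓ σ).Adj (q, 0) (w (p, q)) :=
        liftGraph_adj_of_lt (hUJ q (hBU q hq) _ h1) h3
      refine ⟨.cons ha (.cons hb.symm .nil), ?_, ?_⟩
      · simp [SimpleGraph.Walk.isPath_def, ha.ne, hb.ne.symm, hpq.ne]
      · intro z hz
        left
        refine ⟨h0, by simpa using hz⟩
    · obtain ⟨h1, h2, h3, h4, h5⟩ := hxy _ h0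
      have ha : (liftGraph n ℓ σ).Adj (p, 0) (x (p, q)) :=
        liftGraph_adj_of_lt (hU₁ p (hBU p hp) _ h1) h3
      have hb : (liftGraph n ℓ σ).Adj (q, 0) (y (p, q)) :=
        liftGraph_adj_of_lt (hU₂ q (hBU q hq) _ h2) h4
      have hc : (liftGraph n ℓ σ).Adj (x (p, q)) (y (p, q)) :=
        liftGraph_adj_of_lt (hR _ h1 _ h2) h5
      have hd : (p, 0) ≠ y (p, q) := fun h =>
        (hU₂ p (hBU p hp) _ h2).ne (congrArg Prod.fst h)
      have he : x (p, q) ≠ (q, 0) := fun h =>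
        (hU₁ q (hBU q hq) _ h1).ne (congrArg Prod.fst h).symm
      refine ⟨.cons ha (.cons hc (.cons hb.symm .nil)), ?_, ?_⟩
      · simp [SimpleGraph.Walk.isPath_def, ha.ne, hb.ne.symm, hpq.ne, hc.ne, hd, he]
      · intro z hz
        right
        refine ⟨h0, by simpa using hz⟩
  · intro p hp q hq hpq k hk hkS
    rcases hkS with ⟨h0, h⟩ | ⟨h0, h | h⟩
    · exact (hUJ k (hBU k hk) _ (hwN' _ h0).1).ne (congrArg Prod.fst h)
    · exact (hU₁ k (hBU k hk) _ (hxy _ h0).1).ne (congrArg Prod.fst h)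
    · exact (hU₂ k (hBU k hk) _ (hxy _ h0).2.1).ne (congrArg Prod.fst h)
  · intro p hp q hq p' hp' q' hq' hpq hpq' hne
    rw [Set.disjoint_left]
    have hwx : ∀ e ∈ P \ L, ∀ e' ∈ L', w e ≠ x e' := fun e he e' he' h =>
      hJ₁ _ (hxy e' he').1 (h ▸ (hwN' e he).1)
    have hwy : ∀ e ∈ P \ L, ∀ e' ∈ L', w e ≠ y e' := fun e he e' he' h =>
      hJ₂ _ (hxy e' he').2.1 (h ▸ (hwN' e he).1)
    have hxy' : ∀ e ∈ L', ∀ e' ∈ L', x e ≠ y e' := fun e he e' he' h =>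
      (hR _ (hxy e he).1 _ (hxy e' he').2.1).ne (congrArg Prod.fst h)
    rintro z (⟨h0, rfl⟩ | ⟨h0, rfl | rfl⟩) (⟨h0', h⟩ | ⟨h0', h | h⟩)
    · exact hne (hw h0 h0' h)
    · exact hwx _ h0 _ h0' h
    · exact hwy _ h0 _ h0' h
    · exact hwx _ h0' _ h0 h.symm
    · exact hne (hx h0 h0' h)
    · exact hxy' _ h0 _ h0' h
    · exact hwy _ h0' _ h0 h.symm
    · exact hxy' _ h0' _ h0 h.symm
    · exact hne (hy h0 h0' h)

end Routing

section Probability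

/-- The elements of `Fin n` with value in `[a, b)`. -/
def finIco (n a b : ℕ) : Finset (Fin n) :=
  Finset.univ.filter fun i => a ≤ i.val ∧ i.val < b

theorem mem_finIco {n a b : ℕ} {i : Fin n} : i ∈ finIco n a b ↔ a ≤ i.val ∧ i.val < b := by
  simp [finIco]

theorem card_finIco {n a b : ℕ} (hb : b ≤ n) : (finIco n a b).card = b - a := by
  rw [← Nat.card_Ico, ← Finset.card_map Fin.valEmbedding]
  congr 1
  ext i
  simp only [Finset.mem_map, mem_finIco, Fin.valEmbedding_apply, Finset.mem_Ico]
  constructor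
  · rintro ⟨j, hj, rfl⟩
    exact hj
  · exact fun h => ⟨⟨i, h.2.trans_le hb⟩, h, rfl⟩

theorem two_mul_card_filter_lt_le {ι : Type*} [LinearOrder ι] (U : Finset ι) :
    2 * ((U ×ˢ U).filter fun q => q.1 < q.2).card ≤ U.card ^ 2 := by
  have h1 : ((U ×ˢ U).filter fun q => q.2 < q.1).card = ((U ×ˢ U).filter fun q => q.1 < q.2).card :=
    Finset.card_bij (fun q _ => q.swap) (by simp +contextual) (by simp) (by
      rintro ⟨a, b⟩ h
      exact ⟨(b, a), by simp_all, rfl⟩)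
  have h2 : Disjoint ((U ×ˢ U).filter fun q => q.1 < q.2) ((U ×ˢ U).filter fun q => q.2 < q.1) :=
    Finset.disjoint_filter.2 fun q _ h => h.asymm
  have h3 := Finset.card_le_card (Finset.union_subset
    (Finset.filter_subset (fun q : ι × ι => q.1 < q.2) (U ×ˢ U))
    (Finset.filter_subset (fun q : ι × ι => q.2 < q.1) (U ×ˢ U)))
  rw [Finset.card_union_of_disjoint h2, h1, Finset.card_product] at h3
  linarith [sq U.card]

/-- The Hajós number of a random lift is rarely much smaller than `m`. -/
theorem pr_hajosNumber_lt_le {n ℓ m r k t : ℕ} [NeZero ℓ] {η s lam : ℝ} (hm : 0 < m) (hr : 0 < r)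
    (hmr : m + 2 * r ≤ n) (hη : 0 < η) (hη' : η ≤ 1 / 2) (hs : 0 < s) (hlam : 0 < lam)
    (hk : 2 * Real.exp (-(k / ℓ : ℝ)) ≤ 1)
    (ht : (m : ℝ) ^ 2 / 2 * (1 - 1 / ℓ) + η * (m : ℝ) ^ 2 + t ≤ (n - m - 2 * r) * ℓ) :
    pr (fun σ : Fin n → Fin n → Equiv.Perm (Fin ℓ) => (hajosNumber (liftGraph n ℓ σ) : ℝ) <
      m - 4 * (lam * (3 * k * m) + s / lam) / r) ≤
    Real.exp (-(η ^ 2 * (m : ℝ) ^ 2 / 4)) +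
      (2 ^ (m ^ 2 + n * ℓ) * (2 * Real.exp (-(k / ℓ : ℝ))) ^ t +
      ((m : ℝ) ^ 2 * 4 ^ r * Real.exp (-((r : ℝ) ^ 2 / 4 / ℓ)) +
      (r * (m + (m : ℝ) ^ 2 / ℓ) / s + r * (m + (m : ℝ) ^ 2 / ℓ) / s))) := by
  set U := finIco n 0 m with hU
  set R₁ := finIco n m (m + r) with hR₁
  set R₂ := finIco n (m + r) (m + 2 * r) with hR₂
  set J := finIco n (m + 2 * r) n with hJ
  have hUc : U.card = m := by rw [hU, card_finIco (by omega)]; omega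
  have hR₁c : R₁.card = r := by rw [hR₁, card_finIco (by omega)]; omega
  have hR₂c : R₂.card = r := by rw [hR₂, card_finIco (by omega)]; omega
  have hJc : (J.card : ℝ) = n - m - 2 * r := by
    rw [hJ, card_finIco le_rfl, Nat.cast_sub hmr]
    push_cast
    ring
  have hlt : ∀ {a b c d : ℕ}, b ≤ c → ∀ i ∈ finIco n a b, ∀ j ∈ finIco n c d, i < j := by
    intro a b c d hbc i hi j hj
    rw [mem_finIco] at hi hj
    exact Fin.lt_def.2 (by omega)
  have hUR₁ : Disjoint U R₁ :=
    Finset.disjoint_left.2 fun i hi hi' => (hlt le_rfl i hi i hi').ne rfl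
  have hQ : ((((U ×ˢ U).filter fun q => q.1 < q.2).card : ℕ) : ℝ) ≤ (m : ℝ) ^ 2 / 2 := by
    have h := two_mul_card_filter_lt_le U
    rw [hUc] at h
    have h' : (2 * ((U ×ˢ U).filter fun q => q.1 < q.2).card : ℝ) ≤ (m : ℝ) ^ 2 := by
      exact_mod_cast h
    linarith
  have hB₁ := pr_le_card_ne_zero (ℓ := ℓ) ((U ×ˢ U).filter fun q => q.1 < q.2) hη hη' hQ
  have hB₂ := pr_exists_independent_le (n := n) (ℓ := ℓ) (U := U) (t := t) (by omega) hk
  have hB₃ := pr_exists_no_connection_le (ℓ := ℓ) hR₁c hR₂c hUR₁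
  have hB₄ := pr_le_codegreeSum (ℓ := ℓ) U R₁ hs
  have hB₅ := pr_le_codegreeSum (ℓ := ℓ) U R₂ hs
  rw [hUc] at hB₂ hB₃ hB₄ hB₅
  rw [hR₁c] at hB₄
  rw [hR₂c] at hB₅
  refine (pr_mono ?_).trans ((pr_or_le _ _).trans (add_le_add hB₁ ((pr_or_le _ _).trans
    (add_le_add hB₂ ((pr_or_le _ _).trans (add_le_add hB₃ ((pr_or_le _ _).trans
    (add_le_add hB₄ hB₅))))))))
  intro σ hσ
  by_contra! hc
  obtain ⟨h₁, h₂, h₃, h₄, h₅⟩ := hc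
  rw [Finset.filter_filter] at h₁
  have hcard : ((U ×ˢ U).filter fun q => q.1 < q.2 ∧ σ q.1 q.2 0 ≠ 0).card + t ≤ J.card * ℓ := by
    have : ((((U ×ˢ U).filter fun q => q.1 < q.2 ∧ σ q.1 q.2 0 ≠ 0).card + t : ℕ) : ℝ) ≤
        (J.card * ℓ : ℕ) := by
      push_cast
      rw [hJc]
      linarith
    exact_mod_cast this
  obtain ⟨X₁, X₂, hX₁, hX₂, hclique⟩ := exists_hasTopClique σ U R₁ R₂ J (d := 3 * k * m) (t := t)
    (hlt le_rfl) (hlt (by omega)) (hlt (by omega)) (hlt le_rfl)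
    (fun j hj hj' => (hlt (by omega) j hj j hj').ne rfl)
    (fun j hj hj' => (hlt le_rfl j hj j hj').ne rfl) hR₁c hR₂c
    (fun A hA hAd T hT => by
      by_contra! hTt
      obtain ⟨w, hw, e, he, hwe⟩ := h₂ A hA hAd T hTt
      exact hT w hw e he hwe) hcard h₃
  have hheavy : ∀ R X, X.card ≤ 3 * k * m → (codegreeSum U R σ : ℝ) < s →
      ((heavy σ U R X r).card : ℝ) ≤ 2 * (lam * (3 * k * m) + s / lam) / r := by
    intro R X hX hR
    rw [le_div_iff₀ (by exact_mod_cast hr)]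
    refine (card_heavy_mul_le σ U R X r hlam).trans ?_
    have : (X.card : ℝ) ≤ 3 * k * m := by exact_mod_cast hX
    gcongr
  have h₆ := hheavy R₁ X₁ hX₁ h₄
  have h₇ := hheavy R₂ X₂ hX₂ h₅
  have h₈ := hclique.le_hajosNumber
  have h₉ : m ≤ (U \ (heavy σ U R₁ X₁ r ∪ heavy σ U R₂ X₂ r)).card +
      ((heavy σ U R₁ X₁ r).card + (heavy σ U R₂ X₂ r).card) := by
    have h := Finset.le_card_sdiff (heavy σ U R₁ X₁ r ∪ heavy σ U R₂ X₂ r) U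
    have h' := Finset.card_union_le (heavy σ U R₁ X₁ r) (heavy σ U R₂ X₂ r)
    omega
  have h₁₀ : (m : ℝ) ≤ hajosNumber (liftGraph n ℓ σ) +
      ((heavy σ U R₁ X₁ r).card + (heavy σ U R₂ X₂ r).card) := by
    exact_mod_cast h₉.trans (Nat.add_le_add_right h₈ _)
  have h₁₁ : 4 * (lam * (3 * k * m) + s / lam) / r =
      2 * (lam * (3 * k * m) + s / lam) / r + 2 * (lam * (3 * k * m) + s / lam) / r := by ring
  linarith

end Probability

section Asymptotics

open Filter Topology

theorem tendsto_sq_mul_exp_neg_mul {b : ℝ} (hb : 0 < b) :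
    Tendsto (fun m : ℕ => (m : ℝ) ^ 2 * Real.exp (-(b * m))) atTop (𝓝 0) := by
  have h1 := (Real.tendsto_pow_mul_exp_neg_atTop_nhds_zero 2).comp
    ((tendsto_natCast_atTop_atTop (R := ℝ)).const_mul_atTop hb)
  have h2 := h1.div_const (b ^ 2)
  rw [zero_div] at h2
  refine h2.congr fun m => ?_
  simp only [Function.comp]
  field_simp

theorem tendsto_exp_neg_mul {b : ℝ} (hb : 0 < b) :
    Tendsto (fun m : ℕ => Real.exp (-(b * m))) atTop (𝓝 0) :=
  Real.tendsto_exp_neg_atTop_nhds_zero.comp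
    ((tendsto_natCast_atTop_atTop (R := ℝ)).const_mul_atTop hb)

/-- The asymptotic order of the Hajós number of a random `ℓ`-lift of `K_n`. -/
noncomputable def hajosOrder (n ℓ : ℕ) : ℝ :=
  Real.sqrt (2 * n * ℓ / (1 - 1 / (ℓ : ℝ)))

theorem one_div_le_half {ℓ : ℕ} (hℓ : 2 ≤ ℓ) : 1 / (ℓ : ℝ) ≤ 1 / 2 :=
  one_div_le_one_div_of_le two_pos (by exact_mod_cast hℓ)

theorem hajosOrder_sq_mul {n ℓ : ℕ} (hℓ : 2 ≤ ℓ) :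
    hajosOrder n ℓ ^ 2 * (1 - 1 / (ℓ : ℝ)) = 2 * n * ℓ := by
  have h := one_div_le_half hℓ
  have h' : (0 : ℝ) < 1 - 1 / (ℓ : ℝ) := by linarith
  rw [hajosOrder, Real.sq_sqrt (by positivity), div_mul_cancel₀ _ h'.ne']

theorem two_mul_le_hajosOrder_sq {n ℓ : ℕ} (hℓ : 2 ≤ ℓ) : (2 * n * ℓ : ℝ) ≤ hajosOrder n ℓ ^ 2 := by
  rw [← hajosOrder_sq_mul hℓ]
  have : (0 : ℝ) ≤ 1 / ℓ := by positivity
  nlinarith [sq_nonneg (hajosOrder n ℓ)]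

theorem hajosOrder_sq_le {n ℓ : ℕ} (hℓ : 2 ≤ ℓ) : hajosOrder n ℓ ^ 2 ≤ 4 * n * ℓ := by
  have h := hajosOrder_sq_mul (n := n) hℓ
  nlinarith [sq_nonneg (hajosOrder n ℓ), one_div_le_half hℓ]

theorem hajosOrder_nonneg (n ℓ : ℕ) : 0 ≤ hajosOrder n ℓ := Real.sqrt_nonneg _

/-- A first moment bound for large dense branch sets. -/
theorem pr_exists_dense_le {n ℓ m : ℕ} (hℓ : 1 ≤ ℓ) {η : ℝ} (hη : 0 < η) (hη' : η ≤ 1 / 2) :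
    pr (fun σ : Fin n → Fin n → Equiv.Perm (Fin ℓ) =>
      ∃ S ∈ Finset.powersetCard m (Finset.univ : Finset (Fin n × Fin ℓ)),
        (S.card : ℝ) ^ 2 / 2 / ℓ + η * (S.card : ℝ) ^ 2 ≤ (liftEdges σ S).card) ≤
      ((n * ℓ : ℕ) : ℝ) ^ m * Real.exp (-(η ^ 2 * (m : ℝ) ^ 2 / 4)) := by
  refine (pr_exists_le_card_mul (b := Real.exp (-(η ^ 2 * (m : ℝ) ^ 2 / 4))) _ _
    fun S hS => ?_).trans ?_
  · have h := pr_le_card_liftEdges hℓ S hη hη'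
    rwa [(Finset.mem_powersetCard.1 hS).2] at h ⊢
  · refine mul_le_mul_of_nonneg_right ?_ (Real.exp_nonneg _)
    rw [Finset.card_powersetCard, Finset.card_univ, Fintype.card_prod, Fintype.card_fin,
      Fintype.card_fin]
    exact_mod_cast Nat.choose_le_pow _ _

theorem exists_pr_lt_hajosNumber_le {ε δ : ℝ} (hε : 0 < ε) (hε' : ε ≤ 1 / 2) (hδ : 0 < δ) :
    ∃ N : ℕ, ∀ n : ℕ, N ≤ n → ∀ ℓ : ℕ, 2 ≤ ℓ →
      pr (fun σ : Fin n → Fin n → Equiv.Perm (Fin ℓ) =>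
        (1 + ε) * hajosOrder n ℓ < hajosNumber (liftGraph n ℓ σ)) ≤ δ := by
  set η := ε / 16 with hη
  have hη0 : 0 < η := by positivity
  obtain ⟨N₁, hN₁⟩ := eventually_atTop.1 ((tendsto_sq_mul_exp_neg_mul
    (b := η ^ 2 / 4) (by positivity)).eventually_le_const (lt_min hδ one_pos))
  obtain ⟨N₂, hN₂⟩ := exists_nat_ge (1 / (2 * η))
  set N := max (max N₁ N₂) 1 with hN
  refine ⟨N ^ 2, fun n hn ℓ hℓ => ?_⟩
  set M := hajosOrder n ℓ with hM
  have hM0 : 0 ≤ M := hajosOrder_nonneg n ℓ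
  have hM2 := two_mul_le_hajosOrder_sq (n := n) hℓ
  have hℓ' : (2 : ℝ) ≤ ℓ := by exact_mod_cast hℓ
  set m := ⌊(1 + ε) * M⌋₊ + 1 with hm
  have hmM : (1 + ε) * M < m := by
    rw [hm]
    exact_mod_cast Nat.lt_floor_add_one _
  have hmM' : M ≤ m := by nlinarith
  have hnm : ((n * ℓ : ℕ) : ℝ) ≤ (m : ℝ) ^ 2 := by
    push_cast
    nlinarith [mul_nonneg (Nat.cast_nonneg (α := ℝ) n) (Nat.cast_nonneg (α := ℝ) ℓ)]
  have hNm : N ≤ m := by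
    have h1 : N ^ 2 ≤ m ^ 2 := by
      have : n * ℓ ≤ m ^ 2 := by exact_mod_cast hnm
      nlinarith
    exact (Nat.pow_le_pow_iff_left two_ne_zero).1 h1
  have hN₁m : N₁ ≤ m := ((le_max_left _ _).trans (le_max_left _ _)).trans hNm
  have hN₂m : N₂ ≤ m := ((le_max_right _ _).trans (le_max_left _ _)).trans hNm
  have hm1 : (1 : ℝ) ≤ 2 * η * m := by
    have h : 1 / (2 * η) ≤ m := hN₂.trans (by exact_mod_cast hN₂m)
    rw [div_le_iff₀ (by positivity)] at h
    linarith
  refine (pr_mono fun σ hσ => ?_).trans ((pr_exists_dense_le (m := m) (by omega) hη0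
    (by linarith)).trans ?_)
  · have hmh : m ≤ hajosNumber (liftGraph n ℓ σ) :=
      Nat.succ_le_of_lt ((Nat.floor_lt (by positivity)).2 hσ)
    obtain ⟨S, hSm, hS⟩ := ((hasTopClique_hajosNumber (liftGraph n ℓ σ)).mono hmh).exists_liftEdges
    refine ⟨S, Finset.mem_powersetCard.2 ⟨Finset.subset_univ _, hSm⟩, ?_⟩
    rw [hSm]
    by_contra! hc
    have h1 : (m : ℝ) * (m - 1) / 2 ≤ n * ℓ + (liftEdges σ S).card := by
      rw [← Nat.cast_choose_two]
      exact_mod_cast hS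
    have h2 := hajosOrder_sq_mul (n := n) hℓ
    rw [← hM] at h2
    have h3 := one_div_le_half hℓ
    have h4 : (m : ℝ) ^ 2 / 2 / ℓ = (m : ℝ) ^ 2 / 2 * (1 / ℓ) := by ring
    rw [h4] at hc
    set x := 1 / (ℓ : ℝ)
    have h5 : (m : ℝ) ≤ 2 * η * (m : ℝ) ^ 2 := by nlinarith
    have h6 : (m : ℝ) ^ 2 * (1 - x) < M ^ 2 * (1 - x) + 4 * η * (m : ℝ) ^ 2 := by nlinarith
    have h7 : 4 * η * (m : ℝ) ^ 2 ≤ 8 * η * (m : ℝ) ^ 2 * (1 - x) := by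
      have : 0 ≤ 4 * η * (m : ℝ) ^ 2 := by positivity
      nlinarith
    have h8 : (m : ℝ) ^ 2 * (1 - 8 * η) < M ^ 2 := by
      have : ((m : ℝ) ^ 2 * (1 - 8 * η)) * (1 - x) < M ^ 2 * (1 - x) := by linarith
      exact lt_of_mul_lt_mul_right this (by linarith)
    have h9 : ((1 + ε) * M) ^ 2 ≤ (m : ℝ) ^ 2 := by gcongr
    have h10 : (1 : ℝ) ≤ (1 + ε) ^ 2 * (1 - 8 * η) := by
      rw [hη]
      nlinarith [mul_nonneg hε.le (sub_nonneg.2 hε'), mul_nonneg (sq_nonneg ε) (sub_nonneg.2 hε')]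
    have h11 : 0 ≤ 1 - 8 * η := by rw [hη]; linarith
    have h12 := mul_le_mul_of_nonneg_right h9 h11
    have h13 := mul_le_mul_of_nonneg_left h10 (sq_nonneg M)
    rw [mul_pow, mul_comm ((1 + ε) ^ 2), mul_assoc] at h12
    linarith
  · calc _ ≤ ((m : ℝ) ^ 2) ^ m * Real.exp (-(η ^ 2 * (m : ℝ) ^ 2 / 4)) := by gcongr
      _ = ((m : ℝ) ^ 2 * Real.exp (-(η ^ 2 / 4 * m))) ^ m := by
        rw [mul_pow, ← Real.exp_nat_mul]
        congr 2
        ring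
      _ ≤ (m : ℝ) ^ 2 * Real.exp (-(η ^ 2 / 4 * m)) :=
        pow_le_of_le_one (by positivity) ((hN₁ m hN₁m).trans (min_le_right _ _)) (by omega)
      _ ≤ δ := (hN₁ m hN₁m).trans (min_le_left _ _)

end Asymptotics

section LowerBound

open Filter Topology

/-- The number of edges to be subdivided is smaller than the number of vertices available. -/
theorem subdivided_add_le {ε η x M m n L r t : ℝ} (hε : 0 < ε) (hε' : ε ≤ 1 / 2)
    (hη : η ≤ ε / 32) (hx : x ≤ 1) (hM : M ^ 2 * (1 - x) = 2 * n * L) (hM' : M ^ 2 ≤ 4 * n * L)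
    (hm0 : 0 ≤ m) (hm : m ≤ (1 - ε / 2) * M) (hmn : m ≤ ε / 16 * n) (hr : r ≤ ε / 32 * n)
    (ht : t ≤ ε / 4 * (n * L) + 1) (hn : 8 / ε ≤ n * L) (hL : 0 ≤ L) :
    m ^ 2 / 2 * (1 - x) + η * m ^ 2 + t ≤ (n - m - 2 * r) * L := by
  have hnL : 0 ≤ n * L := le_trans (by positivity) hn
  rw [div_le_iff₀ hε] at hn
  have h1 : m ^ 2 ≤ (1 - ε / 2) ^ 2 * M ^ 2 := by
    rw [← mul_pow]
    gcongr
  have h2 : m ^ 2 / 2 * (1 - x) ≤ (1 - ε / 2) ^ 2 * (n * L) := by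
    have := mul_le_mul_of_nonneg_right h1 (sub_nonneg.2 hx)
    rw [mul_assoc, hM] at this
    linarith
  have h3 : m ^ 2 ≤ 4 * (n * L) := by
    have : (1 - ε / 2) ^ 2 ≤ 1 := pow_le_one₀ (by linarith) (by linarith)
    nlinarith [sq_nonneg M]
  have h4 : η * m ^ 2 ≤ ε / 32 * (4 * (n * L)) := by gcongr
  have h5 : (1 - ε / 2) ^ 2 ≤ 1 - ε + ε / 8 := by nlinarith
  have h6 := mul_le_mul_of_nonneg_right h5 hnL
  have h7 : (m + 2 * r) * L ≤ (ε / 8 * n) * L := by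
    refine mul_le_mul_of_nonneg_right ?_ hL
    linarith
  linarith

/-- The exceptional vertices are few. -/
theorem exceptional_le {ε η C m n L r d : ℝ} (hε : 0 < ε) (hC : 0 < C) (hη : 0 ≤ η)
    (hη' : 2 ^ 18 * C * η ≤ ε ^ 3) (hL : 0 < L) (hm : 0 < m) (hm2 : m ^ 2 ≤ 4 * n * L)
    (hd : d ≤ η * m ^ 2) (hr : ε / 64 * n ≤ r) (hr0 : 0 < r) :
    4 * (32 * C * m / (ε * L) * d + C * r * m ^ 2 / L / (32 * C * m / (ε * L))) / r ≤
      ε / 4 * m := by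
  rw [div_le_iff₀ hr0]
  have h1 : C * r * m ^ 2 / L / (32 * C * m / (ε * L)) = ε * r * m / 32 := by
    field_simp
  have h2 : 32 * C * m / (ε * L) * d ≤ ε * r * m / 32 := by
    rw [div_mul_eq_mul_div, div_le_iff₀ (by positivity)]
    have h3 : 1024 * C * d ≤ ε ^ 2 * r * L := by
      calc 1024 * C * d ≤ 1024 * C * (η * (4 * n * L)) := by
            gcongr
            exact hd.trans (by gcongr)
        _ = (2 ^ 18 * C * η) * (n * L / 64) := by ring
        _ ≤ ε ^ 3 * (n * L / 64) := by
            refine mul_le_mul_of_nonneg_right hη' ?_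
            have : 0 ≤ m ^ 2 := sq_nonneg m
            linarith
        _ = ε ^ 2 * (ε / 64 * n) * L := by ring
        _ ≤ ε ^ 2 * r * L := by gcongr
    nlinarith [mul_le_mul_of_nonneg_right h3 hm.le]
  rw [h1]
  linarith

theorem two_pow_mul_pow_le {a t : ℕ} {ε x y : ℝ} (hε : 0 < ε) (hy : 1 + 24 / ε ≤ y)
    (ha : (a : ℝ) ≤ 5 * x) (ht : ε / 4 * x ≤ t) :
    2 ^ a * (2 * Real.exp (-y)) ^ t ≤ Real.exp (-x) := by
  have h2 : (2 : ℝ) ≤ Real.exp 1 := by linarith [Real.add_one_le_exp (1 : ℝ)]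
  calc (2 : ℝ) ^ a * (2 * Real.exp (-y)) ^ t
      ≤ Real.exp 1 ^ a * (Real.exp 1 * Real.exp (-(1 + 24 / ε))) ^ t := by gcongr
    _ = Real.exp (a - 24 / ε * t) := by
        rw [← Real.exp_add, ← Real.exp_nat_mul, ← Real.exp_nat_mul, ← Real.exp_add]
        congr 1
        ring
    _ ≤ Real.exp (-x) := by
        rw [Real.exp_le_exp]
        have : 24 / ε * (ε / 4 * x) ≤ 24 / ε * t := by gcongr
        have h3 : 24 / ε * (ε / 4 * x) = 6 * x := by
          field_simp
          ring
        linarith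

theorem four_pow_mul_exp_le {r : ℕ} {L : ℝ} (hL : 0 < L) (hr : 12 * L ≤ r) :
    4 ^ r * Real.exp (-((r : ℝ) ^ 2 / 4 / L)) ≤ Real.exp (-r) := by
  have h2 : (2 : ℝ) ≤ Real.exp 1 := by linarith [Real.add_one_le_exp (1 : ℝ)]
  have h4 : (4 : ℝ) ≤ Real.exp 2 := by
    have : Real.exp 2 = Real.exp 1 * Real.exp 1 := by
      rw [← Real.exp_add]
      norm_num
    nlinarith
  calc (4 : ℝ) ^ r * Real.exp (-((r : ℝ) ^ 2 / 4 / L))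
      ≤ Real.exp 2 ^ r * Real.exp (-(3 * r)) := by
        gcongr
        rw [le_div_iff₀ hL]
        nlinarith [Nat.cast_nonneg (α := ℝ) r]
    _ = Real.exp (-r) := by
        rw [← Real.exp_nat_mul, ← Real.exp_add]
        congr 1
        ring

theorem codegree_ratio_le {δ r m L : ℝ} (hδ : 0 < δ) (hL : 0 < L) (hr : 0 < r) (hm : L ≤ m) :
    r * (m + m ^ 2 / L) / (10 / δ * r * m ^ 2 / L) ≤ δ / 5 := by
  have hm0 : 0 < m := hL.trans_le hm
  rw [div_le_iff₀ (by positivity)]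
  have h₁ : δ / 5 * (10 / δ * r * m ^ 2 / L) = 2 * (r * (m ^ 2 / L)) := by
    field_simp
    ring
  have h₂ : m ≤ m ^ 2 / L := by
    rw [le_div_iff₀ hL, sq]
    gcongr
  rw [h₁]
  linarith [mul_le_mul_of_nonneg_left h₂ hr.le]

set_option maxHeartbeats 400000 in
theorem exists_pr_hajosNumber_lt_le {ε δ : ℝ} (hε : 0 < ε) (hε' : ε ≤ 1 / 2) (hδ : 0 < δ) :
    ∃ c : ℝ, 0 < c ∧ ∃ N : ℕ, ∀ n : ℕ, N ≤ n → ∀ ℓ : ℕ, 2 ≤ ℓ → (ℓ : ℝ) ≤ c * n →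
      pr (fun σ : Fin n → Fin n → Equiv.Perm (Fin ℓ) =>
        (hajosNumber (liftGraph n ℓ σ) : ℝ) < (1 - ε) * hajosOrder n ℓ) ≤ δ := by
  set C := 10 / δ with hC
  have hC0 : 0 < C := by positivity
  obtain ⟨η, hη0, hηC, hηε⟩ : ∃ η : ℝ, 0 < η ∧ 2 ^ 18 * C * η ≤ ε ^ 3 ∧ η ≤ ε / 32 :=
    ⟨min (ε ^ 3 / (2 ^ 18 * C)) (ε / 32), by positivity, by
      rw [mul_comm, ← le_div_iff₀ (by positivity)]
      exact min_le_left _ _, min_le_right _ _⟩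
  obtain ⟨c, hc0, hcε, hcη⟩ : ∃ c : ℝ, 0 < c ∧ c ≤ ε / 32 ∧ c * (6 * (2 + 24 / ε)) ≤ η :=
    ⟨min (ε / 32) (η / (6 * (2 + 24 / ε))), by positivity, min_le_left _ _, by
      rw [← le_div_iff₀ (by positivity)]
      exact min_le_right _ _⟩
  obtain ⟨N, hN⟩ := eventually_atTop.1
    ((((tendsto_exp_neg_mul (b := η ^ 2 / 4) (by positivity)).eventually_le_const
      (show 0 < δ / 5 by positivity)).and
    ((tendsto_exp_neg_mul (b := 1) one_pos).eventually_le_const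
      (show 0 < δ / 5 by positivity))).and
    (((tendsto_sq_mul_exp_neg_mul (b := ε / 64) (by positivity)).eventually_le_const
      (show 0 < δ / 5 by positivity)).and
    ((tendsto_natCast_atTop_atTop (R := ℝ)).eventually_ge_atTop (max (64 / ε) (4 / ε ^ 2)))))
  refine ⟨c ^ 2, by positivity, N, fun n hn ℓ hℓ hℓn => ?_⟩
  obtain ⟨⟨hexp₁, hexp₂⟩, hexp₃, hnε⟩ := hN n hn
  have hn₁ : 64 / ε ≤ n := (le_max_left _ _).trans hnε
  have hn₂ : 4 / ε ^ 2 ≤ n := (le_max_right _ _).trans hnε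
  have : NeZero ℓ := ⟨by omega⟩
  have hL : (2 : ℝ) ≤ ℓ := by exact_mod_cast hℓ
  have hnn : (0 : ℝ) < n := lt_of_lt_of_le (by positivity) hn₁
  have hM := hajosOrder_sq_mul (n := n) hℓ
  have hM₁ := two_mul_le_hajosOrder_sq (n := n) hℓ
  have hM₂ := hajosOrder_sq_le (n := n) hℓ
  have hM₀ := hajosOrder_nonneg n ℓ
  set M := hajosOrder n ℓ
  have hnL : (n : ℝ) ≤ n * ℓ := by nlinarith
  have hMε : 4 / ε ≤ M := by
    refine le_of_sq_le_sq ?_ hM₀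
    have : (4 / ε) ^ 2 = 4 * (4 / ε ^ 2) := by ring
    linarith [mul_le_mul_of_nonneg_left hL hnn.le]
  have hM8 : 8 ≤ M := by
    refine le_trans ?_ hMε
    rw [le_div_iff₀ hε]
    linarith
  set m := ⌊(1 - ε / 2) * M⌋₊ with hm
  have hm₁ : (m : ℝ) ≤ (1 - ε / 2) * M := Nat.floor_le (mul_nonneg (by linarith) hM₀)
  have hm₂ : (1 - ε / 2) * M - 1 < m := Nat.sub_one_lt_floor _
  have hεM := mul_le_mul_of_nonneg_right hε' hM₀
  have hm₃ : M / 2 ≤ m := by linarith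
  have hm₄ : (m : ℝ) ≤ M := by linarith [mul_nonneg hε.le hM₀]
  have hm0 : (0 : ℝ) < m := by linarith
  have hm₅ : n * ℓ / 2 ≤ (m : ℝ) ^ 2 := by
    have : (M / 2) ^ 2 ≤ (m : ℝ) ^ 2 := by gcongr
    linarith
  have hm₆ : (m : ℝ) ^ 2 ≤ 4 * n * ℓ := le_trans (by gcongr) hM₂
  have hm₇ : (m : ℝ) ≤ 2 * c * n := by
    refine le_of_sq_le_sq ?_ (by positivity)
    have := mul_le_mul_of_nonneg_left hℓn hnn.le
    linarith
  have hm₈ : (ℓ : ℝ) ≤ 2 * c * m := by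
    refine le_of_sq_le_sq ?_ (by positivity)
    have : (ℓ : ℝ) * ℓ ≤ c ^ 2 * n * ℓ := by gcongr
    have h' : c ^ 2 * (n * ℓ / 2) ≤ c ^ 2 * (m : ℝ) ^ 2 := by gcongr
    have h'' : 0 ≤ (ℓ : ℝ) * ℓ := by positivity
    linarith
  have hℓm : (ℓ : ℝ) ≤ m := by
    have h₁ := mul_le_mul_of_nonneg_right hcε hm0.le
    have h₂ := mul_le_mul_of_nonneg_right hε' hm0.le
    linarith only [h₁, h₂, hm₈, hm0]
  have hm₉ : (m : ℝ) ≤ ε / 16 * n := by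
    have := mul_le_mul_of_nonneg_right hcε hnn.le
    linarith
  have hm₁₀ : (n : ℝ) ≤ (m : ℝ) ^ 2 := by linarith [mul_le_mul_of_nonneg_left hL hnn.le]
  set r := ⌊ε / 32 * n⌋₊ with hr
  have hrn : 1 ≤ ε / 64 * n := by
    rw [div_le_iff₀ hε] at hn₁
    linarith
  have hr₁ : (r : ℝ) ≤ ε / 32 * n := Nat.floor_le (by positivity)
  have hr₂ : ε / 64 * n ≤ r := by
    have := Nat.sub_one_lt_floor (ε / 32 * n)
    linarith
  have hr0 : (0 : ℝ) < r := by linarith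
  have hrL : 12 * (ℓ : ℝ) ≤ r := by
    refine le_trans ?_ hr₂
    have h₁ : c * c ≤ ε / 32 * (1 / 64) := by
      gcongr
      linarith
    have h₂ := mul_le_mul_of_nonneg_right h₁ hnn.le
    have h₃ : 0 ≤ ε * n := by positivity
    linarith
  have hmr : m + 2 * r ≤ n := by
    have : (m + 2 * r : ℝ) ≤ n := by linarith [mul_le_mul_of_nonneg_right hε' hnn.le]
    exact_mod_cast this
  set k := ⌊η * m / 3⌋₊ with hk
  have hk₁ : 3 * (k : ℝ) * m ≤ η * (m : ℝ) ^ 2 := by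
    have : (k : ℝ) ≤ η * m / 3 := Nat.floor_le (by positivity)
    linarith [mul_le_mul_of_nonneg_right this hm0.le]
  have hk₂ : 1 + 24 / ε ≤ (k / ℓ : ℝ) := by
    rw [le_div_iff₀ (by linarith)]
    have h₁ := Nat.sub_one_lt_floor (η * m / 3)
    have h₂ : (2 + 24 / ε) * ℓ ≤ η * m / 3 := by
      calc (2 + 24 / ε) * ℓ ≤ (2 + 24 / ε) * (2 * c * m) := by gcongr
        _ = c * (6 * (2 + 24 / ε)) * m / 3 := by ring
        _ ≤ η * m / 3 := by gcongr
    linarith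
  set t := ⌈ε / 4 * (n * ℓ : ℝ)⌉₊ with ht
  have ht₁ : ε / 4 * (n * ℓ : ℝ) ≤ t := Nat.le_ceil _
  have ht₂ : (t : ℝ) ≤ ε / 4 * (n * ℓ : ℝ) + 1 := (Nat.ceil_lt_add_one (by positivity)).le
  have hpr := pr_hajosNumber_lt_le (n := n) (ℓ := ℓ) (m := m) (r := r) (k := k) (t := t) (η := η)
    (s := C * r * (m : ℝ) ^ 2 / ℓ) (lam := 32 * C * m / (ε * ℓ)) (by exact_mod_cast hm0)
    (by exact_mod_cast hr0) hmr hη0 (by linarith) (by positivity) (by positivity)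
    (by
      have h₁ : Real.exp (-(k / ℓ : ℝ)) ≤ Real.exp (-1) := by
        rw [Real.exp_le_exp]
        have : 0 < 24 / ε := by positivity
        linarith
      have h₂ : Real.exp (-1) ≤ 1 / 2 := by
        rw [Real.exp_neg, ← one_div]
        exact one_div_le_one_div_of_le two_pos (by linarith [Real.add_one_le_exp (1 : ℝ)])
      linarith)
    (subdivided_add_le hε hε' hηε ((one_div_le_half hℓ).trans (by norm_num)) hM hM₂ hm0.le
      hm₁ hm₉ hr₁ ht₂ (le_trans (by gcongr; norm_num) (hn₁.trans hnL)) (by linarith))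
  refine (pr_mono fun σ hσ => lt_of_lt_of_le hσ ?_).trans (hpr.trans ?_)
  · have h₁ := exceptional_le hε hC0 hη0.le hηC (by linarith) hm0 hm₆ hk₁ hr₂ hr0
    rw [div_le_iff₀ hε] at hMε
    linarith [mul_le_mul_of_nonneg_left hm₄ hε.le]
  · have hb₁ : Real.exp (-(η ^ 2 * (m : ℝ) ^ 2 / 4)) ≤ δ / 5 := by
      refine le_trans (Real.exp_le_exp.2 ?_) hexp₁
      have : η ^ 2 / 4 * n ≤ η ^ 2 / 4 * (m : ℝ) ^ 2 := by gcongr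
      linarith
    have hb₂ : 2 ^ (m ^ 2 + n * ℓ) * (2 * Real.exp (-(k / ℓ : ℝ))) ^ t ≤ δ / 5 := by
      refine le_trans (two_pow_mul_pow_le hε (x := n * ℓ) hk₂ ?_ ht₁)
        (le_trans (Real.exp_le_exp.2 ?_) hexp₂)
      · push_cast
        linarith
      · linarith
    have hb₃ : (m : ℝ) ^ 2 * 4 ^ r * Real.exp (-((r : ℝ) ^ 2 / 4 / ℓ)) ≤ δ / 5 := by
      have h₁ := four_pow_mul_exp_le (L := ℓ) (by linarith) hrL
      have h₂ : (m : ℝ) ≤ n := by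
        have : m ≤ n := by omega
        exact_mod_cast this
      rw [mul_assoc]
      refine le_trans ?_ hexp₃
      gcongr
      exact h₁.trans (Real.exp_le_exp.2 (by linarith))
    have hb₄ := codegree_ratio_le (L := ℓ) hδ (by linarith only [hL]) hr0 hℓm
    linarith only [hb₁, hb₂, hb₃, hb₄]

end LowerBound

theorem liftProb_eq_pr (n ℓ : ℕ) (p : SimpleGraph (Fin n × Fin ℓ) → Prop) :
    liftProb n ℓ p =
      pr fun σ : Fin n → Fin n → Equiv.Perm (Fin ℓ) => p (liftGraph n ℓ σ) := by
  rw [liftProb, pr, avg, Finset.sum_boole]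

/-- For every `ε, δ > 0` there exist `c > 0` and `N` such that for all `n ≥ N` and all
integers `2 ≤ ℓ ≤ c n`, with probability at least `1 - δ` the Hajós number `h` of a
uniformly random `ℓ`-lift of `K_n` satisfies
`(1-ε)√(2nℓ/(1-1/ℓ)) ≤ h ≤ (1+ε)√(2nℓ/(1-1/ℓ))`. -/
theorem stmt4 (ε δ : ℝ) (hε : 0 < ε) (hδ : 0 < δ) :
    ∃ c : ℝ, 0 < c ∧ ∃ N : ℕ, ∀ n : ℕ, N ≤ n → ∀ ℓ : ℕ, 2 ≤ ℓ → (ℓ : ℝ) ≤ c * n →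
      1 - δ ≤ liftProb n ℓ (fun G =>
        (1 - ε) * Real.sqrt (2 * n * ℓ / (1 - 1 / (ℓ : ℝ))) ≤ (hajosNumber G : ℝ) ∧
        (hajosNumber G : ℝ) ≤ (1 + ε) * Real.sqrt (2 * n * ℓ / (1 - 1 / (ℓ : ℝ)))) := by
  set ε' := min ε (1 / 2) with hε'
  have hε₀ : 0 < ε' := lt_min hε one_half_pos
  obtain ⟨c, hc, N₁, hN₁⟩ := exists_pr_hajosNumber_lt_le hε₀ (min_le_right _ _) (half_pos hδ)
  obtain ⟨N₂, hN₂⟩ := exists_pr_lt_hajosNumber_le hε₀ (min_le_right _ _) (half_pos hδ)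
  refine ⟨c, hc, max N₁ N₂, fun n hn ℓ hℓ hℓn => ?_⟩
  have : NeZero ℓ := ⟨by omega⟩
  have h₁ := hN₁ n ((le_max_left _ _).trans hn) ℓ hℓ hℓn
  have h₂ := hN₂ n ((le_max_right _ _).trans hn) ℓ hℓ
  rw [liftProb_eq_pr]
  refine le_trans ?_ (one_sub_pr_not_le _)
  rw [sub_le_sub_iff_left]
  refine (pr_mono fun σ hσ => ?_).trans
    ((pr_or_le _ _).trans ((add_le_add h₁ h₂).trans (add_halves δ).le))
  by_contra! hc'
  have hM := hajosOrder_nonneg n ℓ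
  have hεε : ε' ≤ ε := min_le_left _ _
  refine hσ ⟨le_trans ?_ hc'.1, hc'.2.trans ?_⟩
  · exact mul_le_mul_of_nonneg_right (by linarith) hM
  · exact mul_le_mul_of_nonneg_right (by linarith) hM
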